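/- arXiv:2304.08846 — 2 statements merged into one kernel-verified Lean document; each statement's English description precedes it below -/
import Mathlib

section
/- Let k ≥ 5 be an integer and let G be a connected graph of order n ≥ k+2. If the distance spectral radius of G satisfies λ₁(D(G)) ≤ λ₁(D(G*)), where G* = K₁ ∨ (K_{n-k-1} ∪ kK₁), then G admits a spanning k-tree, unless G is isomorphic to G*. -/
/-- The disjoint union `G ∪ H` of two simple graphs (on the sum of the vertex types). -/
def graphDisjUnion {α β : Type*} (G : SimpleGraph α) (H : SimpleGraph β) :
    SimpleGraph (α ⊕ β) :=
  SimpleGraph.fromRel (Sum.LiftRel G.Adj H.Adj)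

/-- The join `G ∨ H` of two simple graphs: the disjoint union together with all edges
between the two parts. -/
def graphJoin {α β : Type*} (G : SimpleGraph α) (H : SimpleGraph β) :
    SimpleGraph (α ⊕ β) :=
  SimpleGraph.fromRel (fun u v => Sum.LiftRel G.Adj H.Adj u v ∨ (u.isLeft ∧ v.isRight))

/-- The distance matrix of a graph: the `(u,v)` entry is the graph distance `d_G(u,v)`. -/
noncomputable def distMatrix {V : Type*} [Fintype V] (G : SimpleGraph V) :
    Matrix V V ℝ :=
  Matrix.of fun u v => (G.dist u v : ℝ)

/-- The distance spectral radius `λ₁(D(G))`: the largest eigenvalue of the distance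
matrix of `G` (for a connected graph the distance matrix is symmetric nonnegative, so this
is the largest element of its real spectrum). -/
noncomputable def distSpecRad {V : Type*} [Fintype V] [DecidableEq V]
    (G : SimpleGraph V) : ℝ :=
  sSup (spectrum ℝ (distMatrix G))

/-- `G` has a spanning `k`-tree: a spanning subgraph which is a tree of maximum degree
at most `k`. -/
def HasSpanningKTree {V : Type*} [Fintype V] (G : SimpleGraph V) (k : ℕ) : Prop :=
  ∃ T : SimpleGraph V, T ≤ G ∧ T.IsTree ∧ ∀ v : V, (T.neighborSet v).ncard ≤ k

/-- The Wiener index `W(G) = ∑_{i<j} d_G(v_i, v_j)`, written as half of the full double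
sum of distances. -/
noncomputable def wiener {V : Type*} [Fintype V] (G : SimpleGraph V) : ℝ :=
  (∑ u : V, ∑ v : V, (G.dist u v : ℝ)) / 2

/-- The graph `G* = K₁ ∨ (K_{n-k-1} ∪ kK₁)`. -/
def starGraph (n k : ℕ) : SimpleGraph (Fin 1 ⊕ (Fin (n - k - 1) ⊕ Fin k)) :=
  graphJoin (⊤ : SimpleGraph (Fin 1))
    (graphDisjUnion (⊤ : SimpleGraph (Fin (n - k - 1))) (⊥ : SimpleGraph (Fin k)))

/-- The graph `G♯ = K_{(n-3)/3} ∨ ((2n+3)/3)K₁`. -/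
def sharpGraph (n : ℕ) : SimpleGraph (Fin ((n - 3) / 3) ⊕ Fin ((2 * n + 3) / 3)) :=
  graphJoin (⊤ : SimpleGraph (Fin ((n - 3) / 3))) (⊥ : SimpleGraph (Fin ((2 * n + 3) / 3)))

/-- The graph `G̃ = K_s ∨ (K_{n-(k-1)s-2} ∪ ((k-2)s+2)K₁)`. -/
def tildeGraph (n k s : ℕ) :
    SimpleGraph (Fin s ⊕ (Fin (n - (k - 1) * s - 2) ⊕ Fin ((k - 2) * s + 2))) :=
  graphJoin (⊤ : SimpleGraph (Fin s))
    (graphDisjUnion (⊤ : SimpleGraph (Fin (n - (k - 1) * s - 2)))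
      (⊥ : SimpleGraph (Fin ((k - 2) * s + 2))))

/-- The graph `G' = K_s ∨ (K_{n-s-(t-1)} ∪ (t-1)K₁)`. -/
def primeGraph (n s t : ℕ) :
    SimpleGraph (Fin s ⊕ (Fin (n - s - (t - 1)) ⊕ Fin (t - 1))) :=
  graphJoin (⊤ : SimpleGraph (Fin s))
    (graphDisjUnion (⊤ : SimpleGraph (Fin (n - s - (t - 1)))) (⊥ : SimpleGraph (Fin (t - 1))))

namespace SimpleGraph

variable {V : Type*}

/-- The graph obtained from `H` by deleting all edges that meet `S`. -/
def isolate (H : SimpleGraph V) (S : Finset V) : SimpleGraph V where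
  Adj u v := H.Adj u v ∧ u ∉ S ∧ v ∉ S
  symm := ⟨fun _ _ h => ⟨h.1.symm, h.2.2, h.2.1⟩⟩
  loopless := ⟨fun _ h => h.1.ne rfl⟩

lemma Reachable.of_forall_adj {A B : SimpleGraph V}
    (h : ∀ u v, A.Adj u v → B.Reachable u v) {u v : V} (huv : A.Reachable u v) :
    B.Reachable u v := by
  obtain ⟨p⟩ := huv
  induction p with
  | nil => exact Reachable.refl _
  | cons hadj _ ih => exact (h _ _ hadj).trans ih

lemma Walk.reachable_of_forall_edges {A B : SimpleGraph V} {u v : V} (p : A.Walk u v)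
    (h : ∀ a b, A.Adj a b → s(a, b) ∈ p.edges → B.Reachable a b) : B.Reachable u v := by
  induction p with
  | nil => exact Reachable.refl _
  | cons hadj q ih =>
    refine (h _ _ hadj (by simp)).trans (ih fun a b hab hmem => h a b hab ?_)
    simp [hmem]

lemma Reachable.mono_of_closed {A B : SimpleGraph V} {C : Set V}
    (hstep : ∀ u v, u ∈ C → A.Adj u v → v ∈ C ∧ B.Adj u v) {u v : V} (hu : u ∈ C)
    (huv : A.Reachable u v) : B.Reachable u v := by
  obtain ⟨p⟩ := huv
  induction p with
  | nil => exact Reachable.refl _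
  | cons hadj _ ih =>
    obtain ⟨hC, hB⟩ := hstep _ _ hu hadj
    exact hB.reachable.trans (ih hC)

lemma isolate_reachable_eq_of_mem {H : SimpleGraph V} {S : Finset V} {u v : V}
    (h : (H.isolate S).Reachable u v) (hu : u ∈ S) : u = v := by
  obtain ⟨p⟩ := h
  cases p with
  | nil => rfl
  | cons hadj _ => exact absurd hu hadj.2.1

/-- `H` is obtained from `T` by rearranging edges inside the components of `T - S`, such that
every vertex outside `S` has degree at most `k`. -/
structure IsRearrangement (G T : SimpleGraph V) (k : ℕ) (S : Finset V) (H : SimpleGraph V) :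
    Prop where
  le : H ≤ G
  adj_iff : ∀ u v, u ∈ S → (H.Adj u v ↔ T.Adj u v)
  reachable_iff : ∀ u v, (H.isolate S).Reachable u v ↔ (T.isolate S).Reachable u v
  degree_le : ∀ v, v ∉ S → (H.neighborSet v).ncard ≤ k

lemma IsRearrangement.exists_glue {G T : SimpleGraph V} {k : ℕ} {S : Finset V}
    {H₁ H₂ : SimpleGraph V} (h₁ : IsRearrangement G T k S H₁) (h₂ : IsRearrangement G T k S H₂)
    {x : V} (hx : x ∉ S) :
    ∃ H, IsRearrangement G T k S H ∧
      (∀ u, (T.isolate S).Reachable x u → H.neighborSet u = H₁.neighborSet u) ∧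
      (∀ u, ¬ (T.isolate S).Reachable x u → H.neighborSet u = H₂.neighborSet u) := by
  classical
  set C : Set V := {u | (T.isolate S).Reachable x u} with hC
  have hCS : ∀ u ∈ C, u ∉ S := fun u hu huS => by
    have := isolate_reachable_eq_of_mem (Reachable.symm hu) huS
    exact hx (this ▸ huS)
  have hstay₁ : ∀ u v, u ∉ S → v ∉ S → H₁.Adj u v → (u ∈ C ↔ v ∈ C) := fun u v hu hv h => by
    have h' : (T.isolate S).Reachable u v :=
      (h₁.reachable_iff u v).1 (Adj.reachable ⟨h, hu, hv⟩)
    exact ⟨fun hc => Reachable.trans hc h', fun hc => Reachable.trans hc h'.symm⟩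
  have hstay₂ : ∀ u v, u ∉ S → v ∉ S → H₂.Adj u v → (u ∈ C ↔ v ∈ C) := fun u v hu hv h => by
    have h' : (T.isolate S).Reachable u v :=
      (h₂.reachable_iff u v).1 (Adj.reachable ⟨h, hu, hv⟩)
    exact ⟨fun hc => Reachable.trans hc h', fun hc => Reachable.trans hc h'.symm⟩
  let H : SimpleGraph V :=
    { Adj := fun u v => (u ∈ C ∧ v ∈ C ∧ H₁.Adj u v) ∨ (¬ (u ∈ C ∧ v ∈ C) ∧ H₂.Adj u v)
      symm := ⟨fun u v h => by
        rcases h with ⟨h1, h2, h3⟩ | ⟨h1, h2⟩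
        · exact Or.inl ⟨h2, h1, h3.symm⟩
        · exact Or.inr ⟨fun h => h1 ⟨h.2, h.1⟩, h2.symm⟩⟩
      loopless := ⟨fun u h => by
        rcases h with ⟨_, _, h3⟩ | ⟨_, h2⟩
        · exact h3.ne rfl
        · exact h2.ne rfl⟩ }
  have hn₁ : ∀ u, u ∈ C → H.neighborSet u = H₁.neighborSet u := fun u hu => by
    ext w
    have huS := hCS u hu
    change ((u ∈ C ∧ w ∈ C ∧ H₁.Adj u w) ∨ (¬ (u ∈ C ∧ w ∈ C) ∧ H₂.Adj u w)) ↔ H₁.Adj u w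
    by_cases hw : w ∈ C
    · simp [hu, hw]
    · by_cases hwS : w ∈ S
      · have e1 := h₁.adj_iff w u hwS
        have e2 := h₂.adj_iff w u hwS
        simp only [H₁.adj_comm w u, H₂.adj_comm w u] at e1 e2
        simp [hw, e1, e2]
      · have e1 := hstay₁ u w huS hwS
        have e2 := hstay₂ u w huS hwS
        tauto
  have hn₂ : ∀ u, u ∉ C → H.neighborSet u = H₂.neighborSet u := fun u hu => by
    ext w
    change ((u ∈ C ∧ w ∈ C ∧ H₁.Adj u w) ∨ (¬ (u ∈ C ∧ w ∈ C) ∧ H₂.Adj u w)) ↔ H₂.Adj u w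
    simp [hu]
  have ha₁ : ∀ u w, u ∈ C → (H.Adj u w ↔ H₁.Adj u w) := fun u w hu => by
    rw [← mem_neighborSet, hn₁ u hu, mem_neighborSet]
  have ha₂ : ∀ u w, u ∉ C → (H.Adj u w ↔ H₂.Adj u w) := fun u w hu => by
    rw [← mem_neighborSet, hn₂ u hu, mem_neighborSet]
  refine ⟨H, ⟨?_, ?_, ?_, ?_⟩, hn₁, hn₂⟩
  · intro u v h
    rcases h with ⟨_, _, h3⟩ | ⟨_, h2⟩
    · exact h₁.le h3
    · exact h₂.le h2
  · intro u v hu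
    rw [ha₂ u v fun h => hCS u h hu]
    exact h₂.adj_iff u v hu
  · intro u v
    constructor
    · refine Reachable.of_forall_adj fun a b hab => ?_
      by_cases ha : a ∈ C
      · exact (h₁.reachable_iff a b).1 (Adj.reachable ⟨(ha₁ a b ha).1 hab.1, hab.2⟩)
      · exact (h₂.reachable_iff a b).1 (Adj.reachable ⟨(ha₂ a b ha).1 hab.1, hab.2⟩)
    · intro h
      by_cases hu : u ∈ C
      · refine Reachable.mono_of_closed (C := C) (fun a b ha hab => ?_) hu
          ((h₁.reachable_iff u v).2 h)
        exact ⟨(hstay₁ a b hab.2.1 hab.2.2 hab.1).1 ha, (ha₁ a b ha).2 hab.1, hab.2⟩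
      · refine Reachable.mono_of_closed (C := Cᶜ) (fun a b ha hab => ?_) hu
          ((h₂.reachable_iff u v).2 h)
        exact ⟨fun hb => ha ((hstay₂ a b hab.2.1 hab.2.2 hab.1).2 hb),
          (ha₂ a b ha).2 hab.1, hab.2⟩
  · intro v hv
    by_cases hvC : v ∈ C
    · rw [hn₁ v hvC]; exact h₁.degree_le v hv
    · rw [hn₂ v hvC]; exact h₂.degree_le v hv

/-- Adding an edge `xy` between two components of `T - S` and deleting an edge of the resulting
cycle at a vertex `v ∈ S`. -/
lemma IsRearrangement.exists_exchange [Finite V] {G T : SimpleGraph V} {k : ℕ} {S : Finset V}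
    {H : SimpleGraph V} (hH : IsRearrangement G T k S H) (hT : T.Connected) {x y : V} (hx : x ∉ S)
    (hy : y ∉ S) (hxy : G.Adj x y) (hdx : (H.neighborSet x).ncard < k)
    (hdy : (H.neighborSet y).ncard < k) {p : T.Walk x y} (hp : p.IsPath)
    {v : V} (hv : v ∈ S) (hvp : v ∈ p.support) {S' : Finset V}
    (hS' : ∀ u, u ∈ S' ↔ u ∈ S ∧ u ∉ p.support) :
    ∃ H' : SimpleGraph V, H' ≤ G ∧ H'.Connected ∧
      (∀ a b, a ∈ S' → (H'.Adj a b ↔ T.Adj a b)) ∧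
      (∀ a b, (H'.isolate S').Reachable a b ↔ (T.isolate S').Reachable a b) ∧
      (∀ u, u ∉ S → (H'.neighborSet u).ncard ≤ k) ∧
      (∀ u, u ∈ S → (H'.neighborSet u).ncard ≤ (T.neighborSet u).ncard) ∧
      (H'.neighborSet v).ncard < (T.neighborSet v).ncard := by
  classical
  have hvx : v ≠ x := fun h => hx (h ▸ hv)
  have hvy : v ≠ y := fun h => hy (h ▸ hv)
  obtain ⟨q, r', rfl⟩ := Walk.mem_support_iff_exists_append.1 hvp
  cases r' with
  | nil => exact absurd rfl hvy
  | @cons _ z _ hvz r =>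
  have hnodup := hp.isTrail.edges_nodup
  simp only [Walk.edges_append, Walk.edges_cons] at hnodup
  have hq : s(v, z) ∉ q.edges := fun h => by
    have := (List.nodup_append.1 hnodup).2.2 _ h _ List.mem_cons_self
    exact this rfl
  have hr : s(v, z) ∉ r.edges := (List.nodup_cons.1 (List.nodup_append.1 hnodup).2.1).1
  set p := q.append (Walk.cons hvz r) with hpdef
  have hsupp : ∀ u, u ∈ p.support → u ∉ S' := fun u hu h => ((hS' u).1 h).2 hu
  have hzp : z ∈ p.support := by simp [hpdef]
  have hxp : x ∈ p.support := by simp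
  have hyp : y ∈ p.support := by simp
  have hS'S : ∀ u, u ∉ S → u ∉ S' := fun u hu h => hu ((hS' u).1 h).1
  let H' : SimpleGraph V :=
    { Adj := fun a b => (H.Adj a b ∧ s(a, b) ≠ s(v, z)) ∨ s(a, b) = s(x, y)
      symm := ⟨fun a b h => by rwa [H.adj_comm, Sym2.eq_swap]⟩
      loopless := ⟨fun a h => by
        rcases h with h | h
        · exact h.1.ne rfl
        · rcases Sym2.eq_iff.1 h with ⟨h1, h2⟩ | ⟨h1, h2⟩
          · exact hxy.ne (h1.symm.trans h2)
          · exact hxy.ne (h2.symm.trans h1)⟩ }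
  have hH'adj : ∀ a b, H'.Adj a b ↔ (H.Adj a b ∧ s(a, b) ≠ s(v, z)) ∨ s(a, b) = s(x, y) :=
    fun _ _ => Iff.rfl
  have hHT : ∀ a b, a ∈ S ∨ b ∈ S → (H.Adj a b ↔ T.Adj a b) := by
    rintro a b (h | h)
    · exact hH.adj_iff a b h
    · rw [H.adj_comm, T.adj_comm]; exact hH.adj_iff b a h
  have hagree : ∀ a b, a ∈ S' → (H'.Adj a b ↔ T.Adj a b) := by
    intro a b ha
    have h1 : a ∉ p.support := ((hS' a).1 ha).2
    have hax : a ≠ x := fun h => h1 (h ▸ hxp)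
    have hay : a ≠ y := fun h => h1 (h ▸ hyp)
    have hav : a ≠ v := fun h => h1 (h ▸ hvp)
    have haz : a ≠ z := fun h => h1 (h ▸ hzp)
    rw [hH'adj, ← hHT a b (Or.inl ((hS' a).1 ha).1)]
    simp [hax, hay, hav, haz]
  have hstep : ∀ a b, T.Adj a b → a ∉ S' → b ∉ S' → s(a, b) ≠ s(v, z) →
      (H'.isolate S').Reachable a b := by
    intro a b hab ha hb hne
    by_cases haS : a ∈ S ∨ b ∈ S
    · exact Adj.reachable ⟨Or.inl ⟨(hHT a b haS).2 hab, hne⟩, ha, hb⟩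
    · push Not at haS
      have h1 : (H.isolate S).Reachable a b :=
        (hH.reachable_iff a b).2 (Adj.reachable ⟨hab, haS⟩)
      refine h1.mono fun c d (hcd : (H.isolate S).Adj c d) => ⟨Or.inl ⟨hcd.1, fun h => ?_⟩, hS'S _ hcd.2.1, hS'S _ hcd.2.2⟩
      have : v ∈ s(c, d) := by rw [h]; simp
      rcases Sym2.mem_iff.1 this with rfl | rfl
      · exact hcd.2.1 hv
      · exact hcd.2.2 hv
  have hwalk : ∀ {a b : V} (w : T.Walk a b), w.support ⊆ p.support → s(v, z) ∉ w.edges →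
      (H'.isolate S').Reachable a b := by
    intro a b w hw hvz'
    refine w.reachable_of_forall_edges fun c d hcd hmem => hstep c d hcd ?_ ?_ ?_
    · exact hsupp _ (hw (w.fst_mem_support_of_mem_edges hmem))
    · exact hsupp _ (hw (w.snd_mem_support_of_mem_edges hmem))
    · rintro h
      exact hvz' (h ▸ hmem)
  have hvzR : (H'.isolate S').Reachable v z := by
    have h1 := hwalk q (by simp [hpdef]) hq
    have h2 := hwalk r (fun u hu => by simp [hpdef, hu]) hr
    have h3 : (H'.isolate S').Reachable x y :=
      Adj.reachable ⟨Or.inr rfl, hS'S x hx, hS'S y hy⟩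
    exact h1.symm.trans (h3.trans h2.symm)
  have hTR : ∀ a b, T.Adj a b → a ∉ S' → b ∉ S' → (H'.isolate S').Reachable a b := by
    intro a b hab ha hb
    by_cases hne : s(a, b) = s(v, z)
    · rcases Sym2.eq_iff.1 hne with ⟨rfl, rfl⟩ | ⟨rfl, rfl⟩
      · exact hvzR
      · exact hvzR.symm
    · exact hstep a b hab ha hb hne
  refine ⟨H', ?_, ?_, hagree, ?_, ?_, ?_, ?_⟩
  · rintro a b (h | h)
    · exact hH.le h.1
    · rcases Sym2.eq_iff.1 h with ⟨rfl, rfl⟩ | ⟨rfl, rfl⟩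
      · exact hxy
      · exact hxy.symm
  · have := hT.nonempty
    refine ⟨fun a b => Reachable.of_forall_adj (fun c d hcd => ?_) (hT.preconnected a b)⟩
    by_cases hc : c ∈ S'
    · exact ((hagree c d hc).2 hcd).reachable
    by_cases hd : d ∈ S'
    · exact ((hagree d c hd).2 hcd.symm).reachable.symm
    · exact (hTR c d hcd hc hd).mono fun _ _ (h : (H'.isolate S').Adj _ _) => h.1
  · intro a b
    constructor
    · refine Reachable.of_forall_adj fun c d hcd => ?_
      rcases hcd.1 with h | h
      · by_cases hS : c ∈ S ∨ d ∈ S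
        · exact Adj.reachable ⟨(hHT c d hS).1 h.1, hcd.2⟩
        · push Not at hS
          have h1 : (T.isolate S).Reachable c d :=
            (hH.reachable_iff c d).1 (Adj.reachable ⟨h.1, hS⟩)
          exact h1.mono fun e f (hef : (T.isolate S).Adj e f) =>
            ⟨hef.1, hS'S _ hef.2.1, hS'S _ hef.2.2⟩
      · have h1 : (T.isolate S').Reachable x y :=
          p.reachable_of_forall_edges fun e f hef hmem => Adj.reachable
            ⟨hef, hsupp _ (p.fst_mem_support_of_mem_edges hmem),
              hsupp _ (p.snd_mem_support_of_mem_edges hmem)⟩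
        rcases Sym2.eq_iff.1 h with ⟨rfl, rfl⟩ | ⟨rfl, rfl⟩
        · exact h1
        · exact h1.symm
    · exact Reachable.of_forall_adj fun c d (hcd : (T.isolate S').Adj c d) =>
        hTR c d hcd.1 hcd.2.1 hcd.2.2
  · intro u hu
    by_cases hux : u = x
    · subst hux
      have : H'.neighborSet u ⊆ insert y (H.neighborSet u) := by
        intro w hw
        rcases hw with h | h
        · exact Or.inr h.1
        · left
          rcases Sym2.eq_iff.1 h with ⟨_, h⟩ | ⟨h1, h2⟩
          · exact h
          · exact absurd h1 hxy.ne
      exact (Set.ncard_le_ncard this (Set.toFinite _)).trans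
        ((Set.ncard_insert_le _ _).trans hdx)
    by_cases huy : u = y
    · subst huy
      have : H'.neighborSet u ⊆ insert x (H.neighborSet u) := by
        intro w hw
        rcases hw with h | h
        · exact Or.inr h.1
        · left
          rcases Sym2.eq_iff.1 h with ⟨h1, h2⟩ | ⟨h1, h2⟩
          · exact absurd h1.symm hxy.ne
          · exact h2
      exact (Set.ncard_le_ncard this (Set.toFinite _)).trans
        ((Set.ncard_insert_le _ _).trans hdy)
    · refine (Set.ncard_le_ncard ?_ (Set.toFinite _)).trans (hH.degree_le u hu)
      intro w hw
      rcases hw with h | h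
      · exact h.1
      · simp [hux, huy] at h
  · intro u hu
    refine Set.ncard_le_ncard ?_ (Set.toFinite _)
    have hux : u ≠ x := fun h => hx (h ▸ hu)
    have huy : u ≠ y := fun h => hy (h ▸ hu)
    intro w hw
    rcases hw with h | h
    · exact (hH.adj_iff u w hu).1 h.1
    · simp [hux, huy] at h
  · refine Set.ncard_lt_ncard ⟨?_, fun h => ?_⟩ (Set.toFinite _)
    · intro w hw
      rcases hw with h | h
      · exact (hH.adj_iff v w hv).1 h.1
      · simp [hvx, hvy] at h
    · have h1 : H'.Adj v z := h hvz
      rcases h1 with h | h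
      · exact h.2 rfl
      · simp [hvx, hvy] at h

lemma isolate_mono {H : SimpleGraph V} {S S' : Finset V} (h : S' ⊆ S) :
    H.isolate S ≤ H.isolate S' :=
  fun _ _ hab => ⟨hab.1, fun ha => hab.2.1 (h ha), fun hb => hab.2.2 (h hb)⟩

lemma reachable_isolate_of_subset {A B : SimpleGraph V} {S S' : Finset V} (h : S' ⊆ S)
    (hadj : ∀ u v, u ∈ S → (A.Adj u v ↔ B.Adj u v))
    (hreach : ∀ u v, (A.isolate S).Reachable u v → (B.isolate S).Reachable u v) {u v : V}
    (huv : (A.isolate S').Reachable u v) : (B.isolate S').Reachable u v := by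
  refine Reachable.of_forall_adj (fun a b hab => ?_) huv
  by_cases ha : a ∈ S
  · exact Adj.reachable ⟨(hadj a b ha).1 hab.1, hab.2⟩
  by_cases hb : b ∈ S
  · exact Adj.reachable ⟨((hadj b a hb).1 hab.1.symm).symm, hab.2⟩
  · exact (hreach a b (Adj.reachable ⟨hab.1, ha, hb⟩)).mono (isolate_mono h)

lemma IsRearrangement.mono {G T : SimpleGraph V} {k : ℕ} {S S' : Finset V}
    {H : SimpleGraph V} (hH : IsRearrangement G T k S H) (h : S' ⊆ S)
    (hdeg : ∀ v ∈ S, v ∉ S' → (T.neighborSet v).ncard ≤ k) : IsRearrangement G T k S' H where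
  le := hH.le
  adj_iff u v hu := hH.adj_iff u v (h hu)
  reachable_iff _ _ :=
    ⟨reachable_isolate_of_subset h hH.adj_iff fun u v => (hH.reachable_iff u v).1,
      reachable_isolate_of_subset h (fun u v hu => (hH.adj_iff u v hu).symm)
        fun u v => (hH.reachable_iff u v).2⟩
  degree_le v hv := by
    by_cases hvS : v ∈ S
    · have : H.neighborSet v = T.neighborSet v := Set.ext fun w => hH.adj_iff v w hvS
      exact this ▸ hdeg v hvS hv
    · exact hH.degree_le v hvS

/-- A spanning tree of minimal total degree excess over `k` has a set `S` of vertices of degree at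
least `k`, containing all vertices of larger degree, such that the components of `T - S` are not
joined by edges of `G`. -/
lemma exists_tree_isolate [Fintype V] {G : SimpleGraph V} (hG : G.Connected) (k : ℕ) :
    ∃ T : SimpleGraph V, T ≤ G ∧ T.IsTree ∧ ∃ S : Finset V,
      (∀ v ∈ S, k ≤ (T.neighborSet v).ncard) ∧ (∀ v ∉ S, (T.neighborSet v).ncard ≤ k) ∧
      ∀ x y, x ∉ S → y ∉ S → G.Adj x y → (T.isolate S).Reachable x y := by
  classical
  let excess : SimpleGraph V → ℕ := fun H => ∑ v, ((H.neighborSet v).ncard - k)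
  have hmono : ∀ {H₁ H₂ : SimpleGraph V}, H₁ ≤ H₂ → excess H₁ ≤ excess H₂ := fun h =>
    Finset.sum_le_sum fun v _ => Nat.sub_le_sub_right
      (Set.ncard_le_ncard (fun w hw => h hw) (Set.toFinite _)) k
  have hne : {H : SimpleGraph V | H ≤ G ∧ H.IsTree}.Nonempty := hG.exists_isTree_le
  obtain ⟨T, ⟨hTG, hT⟩, hmin⟩ := Set.exists_min_image _ excess (Set.toFinite _) hne
  have hmin' : ∀ H : SimpleGraph V, H ≤ G → H.Connected → excess T ≤ excess H := by
    intro H hle hH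
    obtain ⟨T', hT'le, hT'⟩ := hH.exists_isTree_le
    exact (hmin T' ⟨hT'le.trans hle, hT'⟩).trans (hmono hT'le)
  let P : Finset V → Prop := fun S => (∀ v ∈ S, k ≤ (T.neighborSet v).ncard) ∧
    (∀ v ∉ S, (T.neighborSet v).ncard ≤ k) ∧ ∀ v ∉ S, ∃ H, IsRearrangement G T k S H ∧ (H.neighborSet v).ncard < k
  have hPne : {S | P S}.Nonempty := by
    refine ⟨Finset.univ.filter fun v => k ≤ (T.neighborSet v).ncard, by simp,
      fun v hv => ?_, fun v hv => ?_⟩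
    · simp only [Finset.mem_filter, Finset.mem_univ, true_and, not_le] at hv
      exact hv.le
    refine ⟨T, ⟨hTG, fun _ _ _ => Iff.rfl, fun _ _ => Iff.rfl, fun w hw => ?_⟩, ?_⟩
    · simp only [Finset.mem_filter, Finset.mem_univ, true_and, not_le] at hw
      exact hw.le
    · simpa using hv
  obtain ⟨S, ⟨hSk, hlow, hSred⟩, hSmin⟩ := Set.exists_min_image _ Finset.card (Set.toFinite _) hPne
  refine ⟨T, hTG, hT, S, hSk, hlow, fun x y hx hy hxy => ?_⟩
  by_contra hnr
  obtain ⟨H₁, hH₁, hd₁⟩ := hSred x hx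
  obtain ⟨H₂, hH₂, hd₂⟩ := hSred y hy
  obtain ⟨H, hH, hHx, hHy⟩ := hH₁.exists_glue hH₂ hx
  rw [← hHx x (Reachable.refl x)] at hd₁
  rw [← hHy y hnr] at hd₂
  obtain ⟨p, hp⟩ := (hT.connected.preconnected x y).exists_isPath
  set S' := S.filter fun u => u ∉ p.support with hS'
  have hS'mem : ∀ u, u ∈ S' ↔ u ∈ S ∧ u ∉ p.support := fun u => by simp [hS']
  obtain ⟨v, hv, hvp⟩ : ∃ v ∈ S, v ∈ p.support := by
    by_contra! hcon
    refine hnr (p.reachable_of_forall_edges fun a b hab hmem => Adj.reachable ⟨hab, ?_, ?_⟩)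
    · exact fun h => hcon _ h (p.fst_mem_support_of_mem_edges hmem)
    · exact fun h => hcon _ h (p.snd_mem_support_of_mem_edges hmem)
  have hpk : ∀ w ∈ S, w ∈ p.support → (T.neighborSet w).ncard ≤ k := by
    intro w hw hwp
    by_contra! hwk
    obtain ⟨H', hle, hconn, -, -, hdeg, hdegS, hlt⟩ :=
      hH.exists_exchange hT.connected hx hy hxy hd₁ hd₂ hp hw hwp hS'mem
    refine (hmin' H' hle hconn).not_gt (Finset.sum_lt_sum (fun u _ => ?_) ⟨w, by simp, by omega⟩)
    by_cases hu : u ∈ S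
    · exact Nat.sub_le_sub_right (hdegS u hu) k
    · have := hdeg u hu
      omega
  have hlow' : ∀ u ∉ S', (T.neighborSet u).ncard ≤ k := by
    intro u hu
    by_cases huS : u ∈ S
    · refine hpk u huS ?_
      by_contra h
      exact hu ((hS'mem u).2 ⟨huS, h⟩)
    · exact hlow u huS
  have hPS' : P S' := by
    refine ⟨fun u hu => hSk u ((hS'mem u).1 hu).1, hlow', fun u hu => ?_⟩
    by_cases huS : u ∈ S
    · have hup : u ∈ p.support := by
        by_contra h
        exact hu ((hS'mem u).2 ⟨huS, h⟩)
      obtain ⟨H', hle, hconn, hagree, hreach, hdeg, hdegS, hlt⟩ :=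
        hH.exists_exchange hT.connected hx hy hxy hd₁ hd₂ hp huS hup hS'mem
      refine ⟨H', ⟨hle, hagree, hreach, fun w hw => ?_⟩, hlt.trans_le (hpk u huS hup)⟩
      by_cases hwS : w ∈ S
      · exact (hdegS w hwS).trans (hlow' w hw)
      · exact hdeg w hwS
    · obtain ⟨H', hH', hdu⟩ := hSred u huS
      exact ⟨H', hH'.mono (Finset.filter_subset _ _) fun w _ hw => hlow' w hw, hdu⟩
  have hlt : S'.card < S.card := by
    refine Finset.card_lt_card ⟨Finset.filter_subset _ _, fun h => ?_⟩
    exact ((hS'mem v).1 (h hv)).2 hvp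
  exact hlt.not_ge (hSmin S' hPS')

/-- The number of vertices is at most the number of edges plus the number of components. -/
lemma card_le_card_edgeFinset_add_card_connectedComponent [Fintype V] (F : SimpleGraph V)
    [Fintype F.edgeSet] :
    Fintype.card V ≤ F.edgeFinset.card + Nat.card F.ConnectedComponent := by
  classical
  cases isEmpty_or_nonempty V with
  | inl h => simp
  | inr h =>
  obtain ⟨v₀⟩ := h
  let K : Finset (Sym2 V) :=
    (Finset.univ.erase (F.connectedComponentMk v₀)).image fun c => s(v₀, c.out)
  let F' : SimpleGraph V := F ⊔ fromEdgeSet (K : Set (Sym2 V))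
  have hout : ∀ v, F.Reachable v (F.connectedComponentMk v).out := fun v =>
    (ConnectedComponent.exact (Quot.out_eq (F.connectedComponentMk v))).symm
  have hreach : ∀ v, F'.Reachable v₀ v := by
    intro v
    by_cases hv : F.connectedComponentMk v = F.connectedComponentMk v₀
    · exact (ConnectedComponent.exact hv.symm).mono le_sup_left
    · refine Reachable.trans ?_ ((hout v).symm.mono le_sup_left)
      refine Adj.reachable (Or.inr ⟨?_, ?_⟩)
      · simp only [K, Finset.coe_image]
        exact ⟨_, by simpa using hv, rfl⟩
      · intro h
        exact hv (ConnectedComponent.sound (h ▸ hout v))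
  have hconn : F'.Connected := by
    have : Nonempty V := ⟨v₀⟩
    exact ⟨fun u v => (hreach u).symm.trans (hreach v)⟩
  have h1 := hconn.card_vert_le_card_edgeSet_add_one
  have h2 : F'.edgeSet ⊆ ((F.edgeFinset ∪ K : Finset (Sym2 V)) : Set (Sym2 V)) := by
    intro e he
    simp only [F', edgeSet_sup, edgeSet_fromEdgeSet] at he
    simp only [Finset.coe_union, coe_edgeFinset]
    rcases he with he | he
    · exact Or.inl he
    · exact Or.inr he.1
  have h3 : Nat.card F'.edgeSet ≤ (F.edgeFinset ∪ K).card := by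
    have := Set.ncard_le_ncard h2 (Finset.finite_toSet _)
    rwa [Set.ncard_coe_finset] at this
  have h4 := Finset.card_union_le F.edgeFinset K
  have h5 : K.card ≤ Nat.card F.ConnectedComponent - 1 := by
    refine Finset.card_image_le.trans ?_
    rw [Finset.card_erase_of_mem (Finset.mem_univ _), Finset.card_univ, Nat.card_eq_fintype_card]
  have h6 : 0 < Nat.card F.ConnectedComponent := by
    have : Nonempty F.ConnectedComponent := ⟨F.connectedComponentMk v₀⟩
    exact Nat.card_pos
  rw [Nat.card_eq_fintype_card (α := V)] at h1
  omega

open Classical in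
lemma IsAcyclic.card_edgeFinset_filter_lt {T : SimpleGraph V} [Fintype T.edgeSet] (hT : T.IsAcyclic) {S : Finset V} (hS : S.Nonempty) :
    (T.edgeFinset.filter fun e => ∀ v ∈ e, v ∈ S).card < S.card := by
  classical
  have hac : (T.induce (S : Set V)).IsAcyclic := hT.induce _
  have : Nonempty (S : Set V) := hS.to_subtype
  obtain ⟨T', hle, -, hT'⟩ := (connected_top (V := (S : Set V))).exists_isTree_le_of_le_of_isAcyclic
    le_top hac
  have hc := hT'.card_edgeFinset
  have hle' := Finset.card_le_card (edgeFinset_mono hle)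
  have hS' : Fintype.card (S : Set V) = S.card := by simp
  suffices h : (T.edgeFinset.filter fun e => ∀ v ∈ e, v ∈ S).card
      ≤ (T.induce (S : Set V)).edgeFinset.card by omega
  refine (Finset.card_le_card ?_).trans (Finset.card_image_le (f := Sym2.map Subtype.val))
  intro e he
  induction e with
  | _ a b =>
  simp only [Finset.mem_filter, mem_edgeFinset, mem_edgeSet, Sym2.mem_iff, forall_eq_or_imp,
    forall_eq] at he
  simp only [Finset.mem_image, mem_edgeFinset]
  exact ⟨s(⟨a, he.2.1⟩, ⟨b, he.2.2⟩), he.1, rfl⟩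

/-- Deleting a nonempty set `S` from a tree whose degrees on `S` sum to `m`
leaves at least `m - 2|S| + 2` components. -/
lemma IsTree.sum_degree_le_card_components [Fintype V] {T : SimpleGraph V}
    (hT : T.IsTree) {S : Finset V} (hS : S.Nonempty) :
    ∑ v ∈ S, (T.neighborSet v).ncard + 2 ≤
      {c : (T.isolate S).ConnectedComponent |
        ∃ v ∉ S, (T.isolate S).connectedComponentMk v = c}.ncard + 2 * S.card := by
  classical
  have h1 := card_le_card_edgeFinset_add_card_connectedComponent (T.isolate S)
  have h2 := hT.card_edgeFinset
  have h3 : (T.edgeFinset.filter fun e => ∀ v ∈ e, v ∈ S).card < S.card := by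
    convert hT.isAcyclic.card_edgeFinset_filter_lt hS
  have hinc : ∀ v, (T.neighborSet v).ncard = (T.edgeFinset.filter fun e => v ∈ e).card := by
    intro v
    rw [Set.ncard_eq_toFinset_card', ← neighborFinset_def, card_neighborFinset_eq_degree,
      ← card_incidenceFinset_eq_degree, incidenceFinset_eq_filter]
  have h4 : ∑ v ∈ S, (T.neighborSet v).ncard + (T.isolate S).edgeFinset.card ≤
      T.edgeFinset.card + (T.edgeFinset.filter fun e => ∀ v ∈ e, v ∈ S).card := by
    have e1 : (T.isolate S).edgeFinset = T.edgeFinset.filter fun e => ∀ v ∈ e, v ∉ S := by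
      ext e
      induction e with
      | _ a b =>
        rw [mem_edgeFinset, mem_edgeSet, Finset.mem_filter, mem_edgeFinset, mem_edgeSet]
        simp only [isolate, Sym2.mem_iff, forall_eq_or_imp, forall_eq]
    rw [e1]
    simp only [hinc, Finset.card_filter]
    rw [Finset.sum_comm, Finset.card_eq_sum_ones, ← Finset.sum_add_distrib,
      ← Finset.sum_add_distrib]
    refine Finset.sum_le_sum fun e he => ?_
    induction e with
    | _ a b =>
    have hab : a ≠ b := by
      rw [mem_edgeFinset, mem_edgeSet] at he
      exact he.ne
    have e2 : ∑ v ∈ S, (if v ∈ s(a, b) then 1 else 0) =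
        (if a ∈ S then 1 else 0) + (if b ∈ S then 1 else 0) := by
      rw [← Finset.sum_ite_eq' S a fun _ => 1, ← Finset.sum_ite_eq' S b fun _ => 1,
        ← Finset.sum_add_distrib]
      refine Finset.sum_congr rfl fun v _ => ?_
      by_cases hva : v = a
      · subst hva; simp [hab]
      · simp [hva]
    rw [e2]
    by_cases ha : a ∈ S <;> by_cases hb : b ∈ S <;> simp [ha, hb]
  have h5 : Nat.card (T.isolate S).ConnectedComponent ≤ {c : (T.isolate S).ConnectedComponent |
        ∃ v ∉ S, (T.isolate S).connectedComponentMk v = c}.ncard + S.card := by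
    rw [← Set.ncard_univ]
    have : (Set.univ : Set (T.isolate S).ConnectedComponent) ⊆
        {c | ∃ v ∉ S, (T.isolate S).connectedComponentMk v = c} ∪
          ((S.image (T.isolate S).connectedComponentMk : Finset _) : Set _) := by
      intro c _
      induction c using ConnectedComponent.ind with
      | _ v =>
      by_cases hv : v ∈ S
      · right
        exact Finset.mem_coe.2 (Finset.mem_image_of_mem _ hv)
      · exact Or.inl ⟨v, hv, rfl⟩
    refine (Set.ncard_le_ncard this (Set.toFinite _)).trans ((Set.ncard_union_le _ _).trans ?_)
    rw [Set.ncard_coe_finset]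
    exact Nat.add_le_add_left Finset.card_image_le _
  omega

end SimpleGraph

/-- Win's theorem: a connected graph without spanning `k`-tree has a nonempty vertex set `S` whose
deletion leaves at least `(k - 2)|S| + 3` components. -/
theorem exists_separating_set {V : Type*} [Fintype V] {G : SimpleGraph V} (hG : G.Connected)
    {k : ℕ} (hk : 2 ≤ k)
    (hno : ¬ ∃ T : SimpleGraph V, T ≤ G ∧ T.IsTree ∧ ∀ v : V, (T.neighborSet v).ncard ≤ k) :
    ∃ S : Finset V, S.Nonempty ∧ ∃ f : V → Fin ((k - 2) * S.card + 3),
      (∀ i, ∃ v ∉ S, f v = i) ∧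
      ∀ u v, u ∉ S → v ∉ S → G.Adj u v → f u = f v := by
  classical
  obtain ⟨T, hTG, hT, S, hSk, hlow, hcross⟩ := G.exists_tree_isolate hG k
  obtain ⟨v₀, hv₀⟩ : ∃ v, k < (T.neighborSet v).ncard := by
    by_contra! h
    exact hno ⟨T, hTG, hT, h⟩
  have hv₀S : v₀ ∈ S := by
    by_contra h
    exact (hlow v₀ h).not_gt hv₀
  have hcomp := hT.sum_degree_le_card_components ⟨v₀, hv₀S⟩
  have hsum : k * S.card + 1 ≤ ∑ v ∈ S, (T.neighborSet v).ncard := by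
    have : ∑ v ∈ S, k < ∑ v ∈ S, (T.neighborSet v).ncard :=
      Finset.sum_lt_sum hSk ⟨v₀, hv₀S, hv₀⟩
    rw [Finset.sum_const, smul_eq_mul, mul_comm] at this
    exact this
  set C := {c : (T.isolate S).ConnectedComponent |
    ∃ v ∉ S, (T.isolate S).connectedComponentMk v = c} with hC
  have hCcard : (k - 2) * S.card + 3 ≤ C.ncard := by
    have := Nat.mul_le_mul_right S.card hk
    rw [Nat.sub_mul]
    omega
  obtain ⟨g, hg⟩ : ∃ g : C → Fin ((k - 2) * S.card + 3), Function.Surjective g := by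
    have h : Fintype.card (Fin ((k - 2) * S.card + 3)) ≤ Fintype.card C := by
      rw [Fintype.card_fin, ← Nat.card_eq_fintype_card]
      exact hCcard
    obtain ⟨e⟩ := Function.Embedding.nonempty_of_card_le h
    exact ⟨Function.invFun e, Function.invFun_surjective e.injective⟩
  refine ⟨S, ⟨v₀, hv₀S⟩, fun v => if hv : v ∉ S then g ⟨_, v, hv, rfl⟩ else 0, fun i => ?_, ?_⟩
  · obtain ⟨⟨_, v, hv, rfl⟩, rfl⟩ := hg i
    exact ⟨v, hv, by simp [hv]⟩
  · intro u v hu hv huv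
    have h : (T.isolate S).connectedComponentMk u = (T.isolate S).connectedComponentMk v :=
      SimpleGraph.ConnectedComponent.sound (hcross u v hu hv huv)
    simp only [hu, hv, not_false_eq_true, dif_pos]
    congr 2

open Matrix in
lemma Matrix.IsHermitian.dotProduct_mulVec_le {V : Type*} [Fintype V] [DecidableEq V]
    {A : Matrix V V ℝ} (hA : A.IsHermitian) (x : V → ℝ) :
    x ⬝ᵥ A *ᵥ x ≤ sSup (spectrum ℝ A) * (x ⬝ᵥ x) := by
  set μ := sSup (spectrum ℝ A) with hμ
  have hfin : (spectrum ℝ A).Finite := by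
    rw [hA.spectrum_real_eq_range_eigenvalues]
    exact Set.finite_range _
  have hB : (μ • (1 : Matrix V V ℝ) - A).IsHermitian := by
    refine IsHermitian.sub ?_ hA
    simp [IsHermitian]
  have hpsd : (μ • (1 : Matrix V V ℝ) - A).PosSemidef := by
    refine hB.posSemidef_iff_eigenvalues_nonneg.2 fun i => ?_
    have h1 := hB.eigenvalues_mem_spectrum_real i
    simp only [Pi.zero_apply]
    generalize hB.eigenvalues i = θ at h1 ⊢
    rw [← Algebra.algebraMap_eq_smul_one, ← spectrum.singleton_sub_eq] at h1
    obtain ⟨_, rfl, ν, hν, h⟩ := h1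
    have h2 := le_csSup hfin.bddAbove hν
    simp only at h
    linarith
  have h := hpsd.dotProduct_mulVec_nonneg x
  simp only [star_trivial, sub_mulVec, smul_mulVec, one_mulVec, dotProduct_sub,
    dotProduct_smul, smul_eq_mul] at h
  linarith

open Matrix in
lemma Matrix.sSup_spectrum_le_of_mulVec_le {V : Type*} [Fintype V] [DecidableEq V]
    {A : Matrix V V ℝ} (hA : ∀ i j, 0 ≤ A i j) {x : V → ℝ} (hx : ∀ i, 0 < x i) {μ : ℝ}
    (hμ : 0 ≤ μ) (h : ∀ i, (A *ᵥ x) i ≤ μ * x i) : sSup (spectrum ℝ A) ≤ μ := by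
  refine Real.sSup_le (fun ν hν => ?_) hμ
  rw [← Matrix.spectrum_toLin', ← Module.End.hasEigenvalue_iff_mem_spectrum] at hν
  obtain ⟨y, hy⟩ := hν.exists_hasEigenvector
  have hAy : A *ᵥ y = ν • y := by simpa using hy.apply_eq_smul
  obtain ⟨j, hj⟩ : ∃ j, y j ≠ 0 := by
    by_contra! hcon
    exact hy.2 (funext hcon)
  have : Nonempty V := ⟨j⟩
  obtain ⟨i, hi⟩ := Finite.exists_max fun i => |y i| / x i
  set ρ := |y i| / x i with hρ
  have hle : ∀ j, |y j| ≤ ρ * x j := fun j => (div_le_iff₀ (hx j)).1 (hi j)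
  have hρpos : 0 < ρ := (div_pos (abs_pos.2 hj) (hx j)).trans_le (hi j)
  have hyi : |y i| = ρ * x i := by rw [hρ, div_mul_cancel₀ _ (hx i).ne']
  have h1 : |ν| * |y i| ≤ ρ * (μ * x i) := by
    calc |ν| * |y i| = |(A *ᵥ y) i| := by rw [hAy, Pi.smul_apply, smul_eq_mul, abs_mul]
      _ ≤ ∑ j, |A i j * y j| := Finset.abs_sum_le_sum_abs _ _
      _ ≤ ∑ j, ρ * (A i j * x j) := by
        refine Finset.sum_le_sum fun j _ => ?_
        rw [abs_mul, abs_of_nonneg (hA i j), mul_left_comm]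
        exact mul_le_mul_of_nonneg_left (hle j) (hA i j)
      _ = ρ * (A *ᵥ x) i := by rw [← Finset.mul_sum]; rfl
      _ ≤ ρ * (μ * x i) := mul_le_mul_of_nonneg_left (h i) hρpos.le
  rw [hyi, mul_left_comm] at h1
  have h2 := le_of_mul_le_mul_left h1 hρpos
  exact (le_abs_self ν).trans (le_of_mul_le_mul_right h2 (hx i))

/-- The Perron vector of `K₁ ∨ (Kₘ ∪ kK₁)`, normalised to be `1` on `Kₘ`; here `L - 1` is the
eigenvalue. -/
lemma exists_perron_triple (m k : ℝ) (hm : 1 ≤ m) (hk : 5 ≤ k) :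
    ∃ L a c : ℝ, m + k + 1 ≤ L ∧ 0 < a ∧ 0 < c ∧ c * (L + 1) = L + m ∧
      m + k * c = (L - 1) * a ∧ a + (m - 1) + 2 * k * c = L - 1 ∧
      a + 2 * m + 2 * (k - 1) * c = (L - 1) * c := by
  let h : ℝ → ℝ := fun L => (L - 1 - m) * L * (L + 1) - k * (L + m) * (2 * L - 1)
  have hcont : Continuous h := by fun_prop
  set n := m + k + 1 with hn
  have h1 : h n ≤ 0 := by
    have : h n = -(k * (n * (n - 2) + m * (2 * n - 1))) := by simp only [h, hn]; ring
    rw [this, neg_nonpos]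
    have : 0 ≤ n - 2 := by linarith
    have : 0 ≤ 2 * n - 1 := by linarith
    positivity
  have h2 : 0 ≤ h (2 * n) := by
    have : h (2 * n) = 4 * n * (n - k) ^ 2 + 2 * n ^ 2 + k * (9 * n - 1 - k) := by
      simp only [h, hn]; ring
    rw [this]
    have : 0 ≤ 9 * n - 1 - k := by linarith
    have : 0 ≤ n := by linarith
    positivity
  obtain ⟨L, ⟨hL, -⟩, hroot⟩ := intermediate_value_Icc (by linarith : n ≤ 2 * n)
    hcont.continuousOn ⟨h1, h2⟩
  have hL0 : 0 < L := by linarith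
  have hL1 : 0 < L + 1 := by linarith
  have hc : (L + m) / (L + 1) * (L + 1) = L + m := div_mul_cancel₀ _ hL1.ne'
  set c := (L + m) / (L + 1) with hcdef
  have hcpos : 0 < c := div_pos (by linarith) hL1
  have ha : (1 - k * c / L) * L = L - k * c := by field_simp
  have hkc : k * c < L := by
    have : k * (c * (L + 1)) < L * (L + 1) := by rw [hc]; nlinarith
    nlinarith
  set a := 1 - k * c / L with hadef
  have hapos : 0 < a := by
    have : 0 < a * L := by rw [ha]; linarith
    exact pos_of_mul_pos_left this hL0.le
  have hS : (L - 1 - m) * L = k * c * (2 * L - 1) := by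
    have h3 : ((L - 1 - m) * L) * (L + 1) = (k * c * (2 * L - 1)) * (L + 1) := by
      have h4 : (L - 1 - m) * L * (L + 1) - k * (L + m) * (2 * L - 1) = 0 := hroot
      linear_combination h4 - k * (2 * L - 1) * hc
    exact mul_right_cancel₀ hL1.ne' h3
  have e2 : a + (m - 1) + 2 * k * c = L - 1 := by
    refine mul_right_cancel₀ hL0.ne' ?_
    linear_combination ha - hS
  refine ⟨L, a, c, hL, hapos, hcpos, hc, ?_, e2, ?_⟩
  · linear_combination e2 - ha
  · linear_combination e2 - hc

lemma starGraph_adj_inl (n k : ℕ) (i : Fin 1) (v : Fin (n - k - 1) ⊕ Fin k) :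
    (starGraph n k).Adj (Sum.inl i) (Sum.inr v) := by
  simp [starGraph, graphJoin]

lemma starGraph_adj_inr_inl (n k : ℕ) (i j : Fin (n - k - 1)) :
    (starGraph n k).Adj (Sum.inr (Sum.inl i)) (Sum.inr (Sum.inl j)) ↔ i ≠ j := by
  simp only [starGraph, graphJoin, graphDisjUnion, SimpleGraph.fromRel_adj]
  simp
  tauto

lemma not_starGraph_adj_inr_inl_inr (n k : ℕ) (i : Fin (n - k - 1)) (j : Fin k) :
    ¬ (starGraph n k).Adj (Sum.inr (Sum.inl i)) (Sum.inr (Sum.inr j)) := by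
  simp [starGraph, graphJoin, graphDisjUnion]

lemma not_starGraph_adj_inr_inr (n k : ℕ) (i j : Fin k) :
    ¬ (starGraph n k).Adj (Sum.inr (Sum.inr i)) (Sum.inr (Sum.inr j)) := by
  simp [starGraph, graphJoin, graphDisjUnion]

lemma starGraph_dist_inr_le_two (n k : ℕ) (u v : Fin (n - k - 1) ⊕ Fin k) :
    (starGraph n k).dist (Sum.inr u) (Sum.inr v) ≤ 2 :=
  SimpleGraph.dist_le (SimpleGraph.Walk.cons (starGraph_adj_inl n k 0 u).symm
    (SimpleGraph.Walk.cons (starGraph_adj_inl n k 0 v) SimpleGraph.Walk.nil))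

open Matrix in
/-- A positive supersolution of the quotient eigenvalue equations bounds `λ₁(D(G*))`. -/
lemma distSpecRad_starGraph_le {n k : ℕ} {m a c μ : ℝ} (hm : m = ((n - k - 1 : ℕ) : ℝ))
    (ha : 0 < a) (hc : 0 < c) (hμ : 0 ≤ μ) (h₁ : m + k * c ≤ μ * a)
    (h₂ : a + (m - 1) + 2 * k * c ≤ μ) (h₃ : a + 2 * m + 2 * (k - 1) * c ≤ μ * c) :
    distSpecRad (starGraph n k) ≤ μ := by
  have hdist : ∀ u v, (starGraph n k).Adj u v → ((starGraph n k).dist u v : ℝ) = 1 := by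
    intro u v h
    exact_mod_cast SimpleGraph.dist_eq_one_iff_adj.2 h
  have htwo : ∀ u v : Fin (n - k - 1) ⊕ Fin k,
      ((starGraph n k).dist (Sum.inr u) (Sum.inr v) : ℝ) ≤ 2 := fun u v => by
    exact_mod_cast starGraph_dist_inr_le_two n k u v
  have hsum : ∀ (N : ℕ) (i : Fin N) (d : ℝ),
      ∑ j : Fin N, (if i = j then 0 else d) = ((N : ℝ) - 1) * d := by
    intro N i d
    have : ∀ j : Fin N, (if i = j then 0 else d) = d - if i = j then d else 0 := by
      intro j; split_ifs <;> simp
    simp [this, sub_mul]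
  refine Matrix.sSup_spectrum_le_of_mulVec_le (x := Sum.elim (fun _ => a)
    (Sum.elim (fun _ => 1) fun _ => c)) (fun i j => Nat.cast_nonneg _) ?_ hμ ?_
  · rintro (i | i | i) <;> simp [ha, hc]
  · rintro (i | i | i)
    · have e1 : ∀ v, ((starGraph n k).dist (Sum.inl i) (Sum.inr v) : ℝ) = 1 := fun v =>
        hdist _ _ (starGraph_adj_inl n k i v)
      simp [mulVec, dotProduct, Fintype.sum_sum_type, e1, ← hm,
        Subsingleton.elim 0 i]
      linarith
    · have e1 : ((starGraph n k).dist (Sum.inr (Sum.inl i)) (Sum.inl 0) : ℝ) = 1 :=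
        hdist _ _ (starGraph_adj_inl n k 0 _).symm
      have e2 : ∑ j, ((starGraph n k).dist (Sum.inr (Sum.inl i)) (Sum.inr (Sum.inl j)) : ℝ) ≤
          m - 1 := by
        rw [hm, ← mul_one ((_ : ℝ) - 1), ← hsum _ i 1]
        refine Finset.sum_le_sum fun j _ => ?_
        split_ifs with h
        · simp [h]
        · exact (hdist _ _ ((starGraph_adj_inr_inl n k i j).2 h)).le
      have e3 : ∑ j, ((starGraph n k).dist (Sum.inr (Sum.inl i)) (Sum.inr (Sum.inr j)) : ℝ) * c ≤
          k * (2 * c) := by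
        refine (Finset.sum_le_sum fun j _ => mul_le_mul_of_nonneg_right (htwo _ _) hc.le).trans ?_
        simp
      simp [mulVec, dotProduct, Fintype.sum_sum_type, e1]
      linarith
    · have e1 : ((starGraph n k).dist (Sum.inr (Sum.inr i)) (Sum.inl 0) : ℝ) = 1 :=
        hdist _ _ (starGraph_adj_inl n k 0 _).symm
      have e2 : ∑ j, ((starGraph n k).dist (Sum.inr (Sum.inr i)) (Sum.inr (Sum.inl j)) : ℝ) ≤
          m * 2 := by
        refine (Finset.sum_le_sum fun j _ => htwo _ _).trans ?_
        simp [hm]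
      have e3 : ∑ j, ((starGraph n k).dist (Sum.inr (Sum.inr i)) (Sum.inr (Sum.inr j)) : ℝ) * c ≤
          (k - 1) * (2 * c) := by
        rw [← hsum _ i (2 * c)]
        refine Finset.sum_le_sum fun j _ => ?_
        split_ifs with h
        · simp [h]
        · exact mul_le_mul_of_nonneg_right (htwo _ _) hc.le
      simp [mulVec, dotProduct, Fintype.sum_sum_type, e1]
      linarith

/-- The distances in the graph obtained from a complete graph by deleting all edges between
vertices outside `S` that lie in different classes of `f`. -/
noncomputable def classDist {V ι : Type*} (S : Finset V) (f : V → ι) (u v : V) : ℕ :=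
  open Classical in if u = v then 0 else if u ∉ S ∧ v ∉ S ∧ f u ≠ f v then 2 else 1

lemma classDist_le_dist {V ι : Type*} {G : SimpleGraph V} (hG : G.Connected) {S : Finset V}
    {f : V → ι} (hf : ∀ u v, u ∉ S → v ∉ S → G.Adj u v → f u = f v) (u v : V) :
    classDist S f u v ≤ G.dist u v := by
  unfold classDist
  split_ifs with h1 h2
  · simp
  · have h0 := hG.pos_dist_of_ne h1
    have : G.dist u v ≠ 1 := fun h =>
      h2.2.2 (hf u v h2.1 h2.2.1 (SimpleGraph.dist_eq_one_iff_adj.1 h))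
    omega
  · exact hG.pos_dist_of_ne h1

lemma sum_classDist {V ι : Type*} [Fintype V] [DecidableEq V] [Fintype ι] [DecidableEq ι]
    (S : Finset V) (f : V → ι) (x : V → ℝ) :
    ∑ u, ∑ v, (classDist S f u v : ℝ) * (x u * x v) =
      (∑ u, x u) ^ 2 - ∑ u, x u ^ 2 + (∑ u ∈ Sᶜ, x u) ^ 2 -
        ∑ i, (∑ u ∈ Sᶜ with f u = i, x u) ^ 2 := by
  have hpt : ∀ u v, (classDist S f u v : ℝ) * (x u * x v) =
      x u * x v - (if u = v then x u * x v else 0) +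
      (if u ∉ S then x u else 0) * (if v ∉ S then x v else 0) -
      ∑ i, (if u ∉ S ∧ f u = i then x u else 0) * (if v ∉ S ∧ f v = i then x v else 0) := by
    intro u v
    have e : ∑ i, (if u ∉ S ∧ f u = i then x u else 0) * (if v ∉ S ∧ f v = i then x v else 0) =
        if u ∉ S ∧ v ∉ S ∧ f u = f v then x u * x v else 0 := by
      rw [Finset.sum_eq_single (f u)]
      · by_cases hu : u ∈ S <;> by_cases hv : v ∈ S <;> by_cases h : f u = f v <;>
          simp [hu, hv, h, eq_comm]
      · intro i _ hi
        simp [hi.symm]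
      · simp
    rw [e]
    unfold classDist
    by_cases huv : u = v
    · subst huv
      by_cases hu : u ∈ S <;> simp [hu]
    · by_cases hu : u ∈ S <;> by_cases hv : v ∈ S <;> by_cases h : f u = f v <;>
        simp [hu, hv, h, huv]
      ring
  simp only [hpt, Finset.sum_add_distrib, Finset.sum_sub_distrib]
  have e1 : ∑ u, ∑ v, x u * x v = (∑ u, x u) ^ 2 := by
    rw [sq, Finset.sum_mul_sum]
  have e2 : ∑ u, ∑ v, (if u = v then x u * x v else 0) = ∑ u, x u ^ 2 := by
    simp [sq]
  have e3 : ∑ u, ∑ v, (if u ∉ S then x u else 0) * (if v ∉ S then x v else 0) =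
      (∑ u ∈ Sᶜ, x u) ^ 2 := by
    rw [← Finset.sum_mul_sum, ← sq, ← Finset.sum_filter]
    congr 2
    ext; simp
  have e4 : ∑ u, ∑ v, ∑ i, (if u ∉ S ∧ f u = i then x u else 0) *
      (if v ∉ S ∧ f v = i then x v else 0) = ∑ i, (∑ u ∈ Sᶜ with f u = i, x u) ^ 2 := by
    have : ∀ u, ∑ v, ∑ i, (if u ∉ S ∧ f u = i then x u else 0) *
      (if v ∉ S ∧ f v = i then x v else 0) = ∑ i, ∑ v, (if u ∉ S ∧ f u = i then x u else 0) *
      (if v ∉ S ∧ f v = i then x v else 0) := fun u => Finset.sum_comm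
    simp only [this]
    rw [Finset.sum_comm]
    refine Finset.sum_congr rfl fun i _ => ?_
    rw [← Finset.sum_mul_sum, ← sq, ← Finset.sum_filter]
    congr 2
    ext; simp
  rw [e1, e2, e3, e4]

open Matrix in
lemma sum_dist_le_distSpecRad {V : Type*} [Fintype V] [DecidableEq V] (G : SimpleGraph V)
    (x : V → ℝ) :
    ∑ u, ∑ v, (G.dist u v : ℝ) * (x u * x v) ≤ distSpecRad G * ∑ u, x u ^ 2 := by
  have hA : (distMatrix G).IsHermitian := by
    ext u v
    simp [distMatrix, SimpleGraph.dist_comm]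
  have h := hA.dotProduct_mulVec_le x
  have e1 : x ⬝ᵥ distMatrix G *ᵥ x = ∑ u, ∑ v, (G.dist u v : ℝ) * (x u * x v) := by
    simp only [dotProduct, mulVec, distMatrix, Matrix.of_apply, Finset.mul_sum]
    refine Finset.sum_congr rfl fun u _ => Finset.sum_congr rfl fun v _ => ?_
    ring
  have e2 : x ⬝ᵥ x = ∑ u, x u ^ 2 := by simp [dotProduct, sq]
  rwa [e1, e2] at h

/-- Among families with given total, the sum of squares is largest when all the excess weight is
moved to one heaviest member. -/
lemma sum_sq_add_sq_le {ι : Type*} (J : Finset ι) (e r : ι → ℝ) (N : ℝ)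
    (he : ∀ i ∈ J, 0 ≤ e i) (hr : ∀ i ∈ J, e i = 0 ∨ r i < N) :
    (∑ i ∈ J, (r i + e i) ^ 2) + N ^ 2 ≤ ∑ i ∈ J, r i ^ 2 + (N + ∑ i ∈ J, e i) ^ 2 ∧
      ((∃ i ∈ J, e i ≠ 0) → (∑ i ∈ J, (r i + e i) ^ 2) + N ^ 2 <
        ∑ i ∈ J, r i ^ 2 + (N + ∑ i ∈ J, e i) ^ 2) := by
  have h1 := Finset.sum_sq_le_sq_sum_of_nonneg he
  have h2 : ∑ i ∈ J, (r i + e i) ^ 2 =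
      ∑ i ∈ J, r i ^ 2 + 2 * ∑ i ∈ J, r i * e i + ∑ i ∈ J, e i ^ 2 := by
    rw [Finset.mul_sum, ← Finset.sum_add_distrib, ← Finset.sum_add_distrib]
    exact Finset.sum_congr rfl fun i _ => by ring
  have hle : ∀ i ∈ J, r i * e i ≤ N * e i := fun i hi => by
    rcases hr i hi with h | h
    · simp [h]
    · exact mul_le_mul_of_nonneg_right h.le (he i hi)
  have h3 : ∑ i ∈ J, r i * e i ≤ N * ∑ i ∈ J, e i := by
    rw [Finset.mul_sum]
    exact Finset.sum_le_sum hle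
  refine ⟨by nlinarith, fun ⟨i, hi, hne⟩ => ?_⟩
  have h4 : ∑ i ∈ J, r i * e i < N * ∑ i ∈ J, e i := by
    rw [Finset.mul_sum]
    refine Finset.sum_lt_sum hle ⟨i, hi, ?_⟩
    exact mul_lt_mul_of_pos_right ((hr i hi).resolve_left hne) ((he i hi).lt_of_ne' hne)
  nlinarith

/-- The comparison of Rayleigh quotients: a graph whose vertices outside `S` split into mutually
non-adjacent classes is tested against the quotient Perron vector of `G*`. -/
lemma sq_sub_sq_le_of_distSpecRad_le {V ι : Type*} [Fintype V] [DecidableEq V] [Fintype ι]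
    [DecidableEq ι] {G : SimpleGraph V} (hG : G.Connected) {S : Finset V} (hS : S.Nonempty)
    {f : V → ι} (hsurj : ∀ i, ∃ v ∉ S, f v = i)
    (hf : ∀ u v, u ∉ S → v ∉ S → G.Adj u v → f u = f v) {k : ℕ} (hk : k + 1 ≤ Fintype.card ι)
    {L m a c p q : ℝ} (hm : m + k + 1 = Fintype.card V) (hp : p + 1 = Fintype.card ι)
    (hq : q + p + S.card = Fintype.card V) (ha : 0 < a) (hc : 0 < c) (hc2 : c < 2)
    (h₁ : m + k * c = (L - 1) * a) (h₂ : a + (m - 1) + 2 * k * c = L - 1)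
    (h₃ : a + 2 * m + 2 * (k - 1) * c = (L - 1) * c) (hspec : distSpecRad G ≤ L - 1) :
    (q + (p - k) + k * c) ^ 2 - (p - k) - q ^ 2 ≤ (m + k * c) ^ 2 - m ^ 2 ∧
      ((q + (p - k) + k * c) ^ 2 - (p - k) - q ^ 2 = (m + k * c) ^ 2 - m ^ 2 →
        (∀ u v, G.dist u v = classDist S f u v) ∧
        ∃ l, ∀ u v, u ∉ S → v ∉ S → f u = f v → f u ≠ l → u = v) := by
  obtain ⟨v₀, hv₀⟩ := hS
  choose ρ hρS hρ using hsurj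
  have hρinj : Function.Injective ρ := fun i j h => by rw [← hρ i, ← hρ j, h]
  set N : ι → ℕ := fun i => (Finset.univ.filter fun u => u ∉ S ∧ f u = i).card with hN
  have hNpos : ∀ i, 1 ≤ N i := fun i => Finset.card_pos.2 ⟨ρ i, by simp [hρS, hρ]⟩
  obtain ⟨l, -, hl⟩ := Finset.exists_max_image Finset.univ N ⟨f v₀, Finset.mem_univ _⟩
  obtain ⟨I, hI, hIk⟩ := Finset.exists_subset_card_eq (s := Finset.univ.erase l) (n := k) (by
    rw [Finset.card_erase_of_mem (Finset.mem_univ _), Finset.card_univ]; omega)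
  set T := I.image ρ with hT
  have hTk : T.card = k := by rw [hT, Finset.card_image_of_injective _ hρinj, hIk]
  have hTS : ∀ u ∈ T, u ∉ S := by
    simp only [hT, Finset.mem_image]
    rintro _ ⟨i, -, rfl⟩
    exact hρS i
  have hv₀T : v₀ ∉ T := fun h => hTS _ h hv₀
  set x : V → ℝ := fun u => if u = v₀ then a else if u ∈ T then c else 1 with hx
  have hxpos : ∀ u, 0 < x u := fun u => by
    simp only [hx]; split_ifs <;> positivity
  have hφ : ∀ φ : ℝ → ℝ, ∑ u, φ (x u) =
      Fintype.card V * φ 1 + (φ a - φ 1) + k * (φ c - φ 1) := fun φ => by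
    have : ∀ u, φ (x u) = φ 1 + (if u = v₀ then φ a - φ 1 else 0) +
        if u ∈ T then φ c - φ 1 else 0 := fun u => by
      by_cases hu : u = v₀
      · subst hu; simp [hx, hv₀T]
      · by_cases hu' : u ∈ T <;> simp [hx, hu, hu']
    simp [this, Finset.sum_add_distrib, hTk, mul_sub]
  have hX := hφ id
  have hN2 := hφ fun y => y ^ 2
  simp only [id] at hX
  set r : ι → ℝ := fun i => if i ∈ I then c else 1 with hr
  have hw : ∀ i, ∑ u ∈ Sᶜ with f u = i, x u = r i + ((N i : ℝ) - 1) := fun i => by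
    have hfil : (Sᶜ.filter fun u => f u = i) = Finset.univ.filter fun u => u ∉ S ∧ f u = i := by
      ext; simp
    have : ∀ u ∈ Sᶜ.filter fun u => f u = i, x u = 1 + if u = ρ i then r i - 1 else 0 := by
      intro u hu
      simp only [Finset.mem_filter, Finset.mem_compl] at hu
      have hne : u ≠ v₀ := fun h => hu.1 (h ▸ hv₀)
      have hiff : u ∈ T ↔ u = ρ i ∧ i ∈ I := by
        simp only [hT, Finset.mem_image]
        constructor
        · rintro ⟨j, hj, rfl⟩
          have : j = i := by rw [← hu.2, hρ]
          subst this; exact ⟨rfl, hj⟩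
        · rintro ⟨rfl, h⟩; exact ⟨i, h, rfl⟩
      simp only [hx, hr, if_neg hne, hiff]
      by_cases h1 : u = ρ i <;> by_cases h2 : i ∈ I <;> simp [h1, h2]
    rw [Finset.sum_congr rfl this, Finset.sum_add_distrib, Finset.sum_ite_eq', if_pos (by
      simp [hρS, hρ]), hfil]
    simp [hN]
    ring
  have hNsum : ∑ i, (N i : ℝ) = Fintype.card V - S.card := by
    have h1 : Sᶜ.card = ∑ i, N i := by
      rw [Finset.card_eq_sum_card_fiberwise (f := f) (t := Finset.univ) (by simp)]
      refine Finset.sum_congr rfl fun i _ => ?_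
      simp only [hN]
      congr 1
      ext; simp
    have h2 := Finset.card_compl_add_card S
    rw [h1] at h2
    rw [← h2]; push_cast; ring
  have hrsum : ∀ φ : ℝ → ℝ, ∑ i ∈ Finset.univ.erase l, φ (r i) = k * φ c + (p - k) * φ 1 := by
    intro φ
    have : ∀ i, φ (r i) = φ 1 + if i ∈ I then φ c - φ 1 else 0 := fun i => by
      simp only [hr]; split_ifs <;> ring
    simp only [this, Finset.sum_add_distrib]
    rw [Finset.sum_ite_mem, Finset.inter_eq_right.2 hI, Finset.sum_const, Finset.sum_const, hIk,
      Finset.card_erase_of_mem (Finset.mem_univ _), Finset.card_univ, nsmul_eq_mul, nsmul_eq_mul,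
      Nat.cast_sub (by omega), ← hp]
    push_cast; ring
  have hrl : r l = 1 := by
    have : l ∉ I := fun h => by simpa using hI h
    simp [hr, this]
  have hNe : (N l : ℝ) + ∑ i ∈ Finset.univ.erase l, ((N i : ℝ) - 1) = q := by
    rw [Finset.sum_sub_distrib]
    have := Finset.add_sum_erase Finset.univ (fun i => (N i : ℝ)) (Finset.mem_univ l)
    have h2 := hrsum fun _ => 1
    simp only [Finset.sum_const, Finset.card_erase_of_mem (Finset.mem_univ _), Finset.card_univ,
      nsmul_eq_mul] at h2 ⊢
    linarith
  obtain ⟨hle, hlt⟩ := sum_sq_add_sq_le (Finset.univ.erase l) (fun i => (N i : ℝ) - 1) r (N l)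
    (fun i _ => by have : (1 : ℝ) ≤ N i := by exact_mod_cast hNpos i
                   linarith)
    (fun i _ => by
      by_cases h : N i = 1
      · left; simp [h]
      · right
        have h1 : (2 : ℝ) ≤ N l := by
          have := hNpos i; have := hl i (Finset.mem_univ _)
          exact_mod_cast (by omega : 2 ≤ N l)
        simp only [hr]; split_ifs <;> linarith)
  rw [hrsum fun y => y ^ 2, hNe] at hle hlt
  have hwsq : ∑ i, (∑ u ∈ Sᶜ with f u = i, x u) ^ 2 =
      ∑ i ∈ Finset.univ.erase l, (r i + ((N i : ℝ) - 1)) ^ 2 + (N l : ℝ) ^ 2 := by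
    rw [← Finset.sum_erase_add _ _ (Finset.mem_univ l), hw l, hrl]
    simp [hw]
  have hW : ∑ u ∈ Sᶜ, x u = q + (p - k) + k * c := by
    rw [← Finset.sum_fiberwise Sᶜ f x, ← Finset.sum_erase_add _ _ (Finset.mem_univ l)]
    simp only [hw, hrl, Finset.sum_add_distrib]
    have := hrsum id
    simp only [id] at this
    linarith
  have hcd := sum_classDist S f x
  rw [hwsq, hW, hX, hN2] at hcd
  have hpt : ∀ u v, (classDist S f u v : ℝ) * (x u * x v) ≤ (G.dist u v : ℝ) * (x u * x v) :=
    fun u v => mul_le_mul_of_nonneg_right (by exact_mod_cast classDist_le_dist hG hf u v)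
      (mul_pos (hxpos u) (hxpos v)).le
  have hD : ∑ u, ∑ v, (classDist S f u v : ℝ) * (x u * x v) ≤
      ∑ u, ∑ v, (G.dist u v : ℝ) * (x u * x v) :=
    Finset.sum_le_sum fun u _ => Finset.sum_le_sum fun v _ => hpt u v
  have hR := sum_dist_le_distSpecRad G x
  rw [hN2] at hR
  have hR' : distSpecRad G * (Fintype.card V * 1 ^ 2 + (a ^ 2 - 1 ^ 2) + k * (c ^ 2 - 1 ^ 2)) ≤
      (L - 1) * (Fintype.card V * 1 ^ 2 + (a ^ 2 - 1 ^ 2) + k * (c ^ 2 - 1 ^ 2)) := by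
    refine mul_le_mul_of_nonneg_right hspec ?_
    rw [← hN2]
    positivity
  have hid : (L - 1) * (Fintype.card V * 1 ^ 2 + (a ^ 2 - 1 ^ 2) + k * (c ^ 2 - 1 ^ 2)) =
      (a + m + k * c) ^ 2 - (a ^ 2 + m + k * c ^ 2) + (m + k * c) ^ 2 - k * c ^ 2 - m ^ 2 := by
    rw [← hm]
    linear_combination -a * h₁ - m * h₂ - k * c * h₃
  rw [← hm] at hcd
  have hX' : (m + k + 1) * 1 + (a - 1) + k * (c - 1) = a + m + k * c := by ring
  rw [hX'] at hcd
  refine ⟨by linarith, fun heq => ⟨fun u v => ?_, l, fun u v hu hv huv hne => ?_⟩⟩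
  · by_contra hne
    have hlt' : ∑ u, ∑ v, (classDist S f u v : ℝ) * (x u * x v) <
        ∑ u, ∑ v, (G.dist u v : ℝ) * (x u * x v) := by
      refine Finset.sum_lt_sum (fun u _ => Finset.sum_le_sum fun v _ => hpt u v)
        ⟨u, Finset.mem_univ _, Finset.sum_lt_sum (fun v _ => hpt u v) ⟨v, Finset.mem_univ _, ?_⟩⟩
      refine mul_lt_mul_of_pos_right ?_ (mul_pos (hxpos u) (hxpos v))
      exact_mod_cast (classDist_le_dist hG hf u v).lt_of_ne' hne
    linarith
  · by_contra hne'
    have h2 : 1 < N (f u) := Finset.one_lt_card.2 ⟨u, by simp [hu], v, by simp [hv, huv], hne'⟩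
    have h3 : (1 : ℝ) < N (f u) := by exact_mod_cast h2
    have := hlt ⟨f u, by simp [hne], by linarith⟩
    linarith

lemma nonempty_iso_starGraph {V ι : Type*} [Fintype V] [DecidableEq V] [Fintype ι]
    [DecidableEq ι] {G : SimpleGraph V} {S : Finset V} (hS : S.card = 1) {f : V → ι}
    (hsurj : ∀ i, ∃ v ∉ S, f v = i) {k : ℕ} (hk : Fintype.card ι = k + 1)
    (hadj : ∀ u v, G.Adj u v ↔ u ≠ v ∧ (u ∈ S ∨ v ∈ S ∨ f u = f v)) (l : ι)
    (hl : ∀ u v, u ∉ S → v ∉ S → f u = f v → f u ≠ l → u = v) :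
    Nonempty (G ≃g starGraph (Fintype.card V) k) := by
  obtain ⟨v₀, rfl⟩ := Finset.card_eq_one.1 hS
  simp only [Finset.mem_singleton] at *
  choose ρ hρS hρ using hsurj
  have hρinj : Function.Injective ρ := fun i j h => by rw [← hρ i, ← hρ j, h]
  have hJ : (Finset.univ.erase l).card = k := by
    rw [Finset.card_erase_of_mem (Finset.mem_univ _), Finset.card_univ, hk]; simp
  set C := (Finset.univ.erase l).image ρ with hC
  have hv₀C : v₀ ∉ C := by
    simp only [hC, Finset.mem_image, not_exists, not_and]
    exact fun i _ => hρS i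
  have hB : (insert v₀ C)ᶜ.card = Fintype.card V - k - 1 := by
    rw [Finset.card_compl, Finset.card_insert_of_notMem hv₀C, hC,
      Finset.card_image_of_injective _ hρinj, hJ]
    omega
  have hBf : ∀ u ∈ (insert v₀ C)ᶜ, u ≠ v₀ ∧ f u = l := by
    intro u hu
    simp only [Finset.mem_compl, Finset.mem_insert, not_or] at hu
    refine ⟨hu.1, ?_⟩
    by_contra h
    refine hu.2 (Finset.mem_image.2 ⟨f u, by simp [h], ?_⟩)
    exact (hl _ _ hu.1 (hρS _) (hρ _).symm h).symm
  set eB := (Finset.equivFinOfCardEq hB).symm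
  set eC := (Finset.equivFinOfCardEq hJ).symm
  have hCl : ∀ j, ((eC j : ι)) ≠ l := fun j => Finset.ne_of_mem_erase (eC j).2
  set g : Fin 1 ⊕ (Fin (Fintype.card V - k - 1) ⊕ Fin k) → V :=
    Sum.elim (fun _ => v₀) (Sum.elim (fun j => eB j) fun j => ρ (eC j)) with hg
  have hBne : ∀ j, (eB j : V) ≠ v₀ := fun j => (hBf _ (eB j).2).1
  have hBl : ∀ j, f (eB j : V) = l := fun j => (hBf _ (eB j).2).2
  have hBC : ∀ i j, (eB i : V) ≠ ρ (eC j) := fun i j h => hCl j (by rw [← hρ (eC j), ← h, hBl])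
  have hinj : Function.Injective g := by
    rintro (i | i | i) (j | j | j) h
    · simp [Subsingleton.elim i j]
    · exact absurd h.symm (hBne j)
    · exact absurd h.symm (hρS _)
    · exact absurd h (hBne i)
    · simpa [hg, Subtype.ext_iff.symm] using h
    · exact absurd h (hBC i j)
    · exact absurd h (hρS _)
    · exact absurd h.symm (hBC j i)
    · simpa [hg, hρinj.eq_iff] using h
  have hcard : k + 1 ≤ Fintype.card V := by
    have := Finset.card_le_univ (insert v₀ C)
    rwa [Finset.card_insert_of_notMem hv₀C, hC, Finset.card_image_of_injective _ hρinj, hJ] at this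
  have hbij : Function.Bijective g := (Fintype.bijective_iff_injective_and_card g).2
    ⟨hinj, by simp; omega⟩
  refine ⟨(RelIso.mk (Equiv.ofBijective g hbij) ?_ : starGraph (Fintype.card V) k ≃g G).symm⟩
  intro u v
  simp only [Equiv.ofBijective_apply, hadj, hinj.ne_iff]
  rcases u with (i | i | i) <;> rcases v with (j | j | j)
  · simp [Subsingleton.elim i j]
  · simp [hg, starGraph_adj_inl]
  · simp [hg, starGraph_adj_inl]
  · simp [hg, (starGraph_adj_inl _ _ _ _).symm]
  · simp [hg, starGraph_adj_inr_inl, hBl]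
  · simp [hg, not_starGraph_adj_inr_inl_inr, hBne, hρS, hBl, hρ, (hCl j).symm]
  · simp [hg, (starGraph_adj_inl _ _ _ _).symm]
  · have := mt SimpleGraph.Adj.symm (not_starGraph_adj_inr_inl_inr (Fintype.card V) k j i)
    simp [hg, this, hBne, hρS, hBl, hρ, hCl i]
  · simp [hg, not_starGraph_adj_inr_inr, hρS, hρ, Subtype.ext_iff.symm]

/-- The one case that the Perron vector of `G*` does not settle: two cut vertices leaving nine
isolated vertices. -/
lemma lt_distSpecRad_of_nine_classes {V ι : Type*} [Fintype V] [DecidableEq V] [Fintype ι]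
    [DecidableEq ι] {G : SimpleGraph V} (hG : G.Connected) {S : Finset V} (hS : S.card = 2)
    (hV : Fintype.card V = 11) (hι : Fintype.card ι = 9) {f : V → ι}
    (hsurj : ∀ i, ∃ v ∉ S, f v = i)
    (hf : ∀ u v, u ∉ S → v ∉ S → G.Adj u v → f u = f v) : 17 < distSpecRad G := by
  have hSc : Sᶜ.card = 9 := by rw [Finset.card_compl, hV, hS]
  have hN : ∀ i, (Sᶜ.filter fun u => f u = i).card = 1 := by
    have h1 : ∀ i ∈ Finset.univ, 1 ≤ (Sᶜ.filter fun u => f u = i).card := fun i _ => by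
      obtain ⟨v, hv, rfl⟩ := hsurj i
      exact Finset.card_pos.2 ⟨v, by simp [hv]⟩
    have h2 := Finset.card_eq_sum_card_fiberwise (f := f) (s := Sᶜ) (t := Finset.univ) (by simp)
    have h3 := (Finset.sum_eq_sum_iff_of_le h1).1 (by rw [← h2, hSc]; simp [hι])
    exact fun i => (h3 i (Finset.mem_univ _)).symm
  set x : V → ℝ := fun u => if u ∈ S then 1 else 2 with hx
  have hφ : ∀ φ : ℝ → ℝ, ∑ u, φ (x u) = 2 * φ 1 + 9 * φ 2 := fun φ => by
    have h1 : ∑ u ∈ S, φ (x u) = 2 * φ 1 := by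
      rw [Finset.sum_congr rfl (g := fun _ => φ 1) fun u hu => by simp [hx, hu]]
      simp [hS]
    have h2 : ∑ u ∈ Sᶜ, φ (x u) = 9 * φ 2 := by
      rw [Finset.sum_congr rfl (g := fun _ => φ 2) fun u hu => by
        simp [hx, Finset.mem_compl.1 hu]]
      simp [hSc]
    rw [← Finset.sum_add_sum_compl S, h1, h2]
  have hX := hφ id
  have hN2 := hφ fun y => y ^ 2
  simp only [id] at hX
  have hout : ∀ A ⊆ Sᶜ, ∑ u ∈ A, x u = 2 * A.card := fun A hA => by
    rw [Finset.sum_congr rfl (g := fun _ => (2 : ℝ)) fun u hu => by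
      simp [hx, Finset.mem_compl.1 (hA hu)]]
    simp [mul_comm]
  have hcd := sum_classDist S f x
  simp only [hX, hN2, hout _ subset_rfl, hout _ (Finset.filter_subset _ _), hN, hSc,
    Finset.sum_const, Finset.card_univ, hι] at hcd
  have hD : ∑ u, ∑ v, (classDist S f u v : ℝ) * (x u * x v) ≤
      ∑ u, ∑ v, (G.dist u v : ℝ) * (x u * x v) := by
    refine Finset.sum_le_sum fun u _ => Finset.sum_le_sum fun v _ => ?_
    refine mul_le_mul_of_nonneg_right (by exact_mod_cast classDist_le_dist hG hf u v) ?_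
    refine mul_nonneg ?_ ?_ <;> simp only [hx] <;> split_ifs <;> norm_num
  have hR := sum_dist_le_distSpecRad G x
  rw [hN2] at hR
  norm_num at hcd hR
  linarith

lemma eq_of_mul_lt_of_five_le {k j q : ℕ} (hk : 5 ≤ k) (hj : 1 ≤ j) (hq : 1 ≤ q)
    (h : (k - 2) * ((k - 2) * j + 2 * q) < 4 * k + (k - 2)) :
    j = 1 ∧ (k = 5 ∧ (q = 1 ∨ q = 2) ∨ k = 6 ∧ q = 1) := by
  obtain ⟨d, rfl⟩ := Nat.exists_eq_add_of_le' hk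
  simp only [show d + 5 - 2 = d + 3 by omega] at h
  have h1 : (d + 3) * ((d + 3) * 1 + 2 * 1) ≤ (d + 3) * ((d + 3) * j + 2 * q) := by gcongr
  have hd : d < 2 := by nlinarith
  interval_cases d <;> omega

/-- **Theorem (Statement 0).** Let `k ≥ 5` and let `G` be a connected graph of order
`n ≥ k+2`. If `λ₁(D(G)) ≤ λ₁(D(G*))` where `G* = K₁ ∨ (K_{n-k-1} ∪ kK₁)`, then
`G` admits a spanning `k`-tree, unless `G ≅ G*`. -/
theorem spanning_k_tree_of_distSpecRad {V : Type*} [Fintype V] [DecidableEq V]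
    (k n : ℕ) (hk : 5 ≤ k) (hcard : Fintype.card V = n) (hn : k + 2 ≤ n)
    (G : SimpleGraph V) (hG : G.Connected)
    (hspec : distSpecRad G ≤ distSpecRad (starGraph n k)) :
    HasSpanningKTree G k ∨ Nonempty (G ≃g starGraph n k) := by
  refine or_iff_not_imp_left.2 fun hno => ?_
  subst hcard
  obtain ⟨S, hS, f, hsurj, hf⟩ := exists_separating_set hG (by omega : 2 ≤ k) hno
  obtain ⟨m, hm⟩ : ∃ m, m + k + 1 = Fintype.card V := ⟨Fintype.card V - k - 1, by omega⟩
  have hmk : m = Fintype.card V - k - 1 := by omega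
  have hfib : (k - 2) * S.card + 3 ≤ Sᶜ.card := by
    have := Finset.card_le_card (s := (Finset.univ : Finset (Fin ((k - 2) * S.card + 3))))
      (t := Sᶜ.image f) fun i _ => by
        obtain ⟨v, hv, h⟩ := hsurj i
        exact Finset.mem_image.2 ⟨v, by simpa using hv, h⟩
    have h2 := Finset.card_image_le (s := Sᶜ) (f := f)
    simp only [Finset.card_univ, Fintype.card_fin] at this
    omega
  have hSc := Finset.card_compl_add_card S
  obtain ⟨q, hq⟩ : ∃ q, q + ((k - 2) * S.card + 2) + S.card = Fintype.card V :=
    ⟨Fintype.card V - S.card - ((k - 2) * S.card + 2), by omega⟩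
  have hq1 : 1 ≤ q := by omega
  obtain ⟨j, hj⟩ : ∃ j, S.card = j + 1 := ⟨S.card - 1, by have := hS.card_pos; omega⟩
  have hι : (k - 2) * S.card + 3 = (k - 2) * j + k + 1 := by
    rw [hj, Nat.mul_succ]; omega
  have hmq : m = q + j + (k - 2) * j := by
    rw [hj, Nat.mul_succ] at hq; omega
  obtain ⟨L, a, c, hL, ha, hc, hcL, e₁, e₂, e₃⟩ := exists_perron_triple (m : ℝ) k
    (by exact_mod_cast (by omega : 1 ≤ m)) (by exact_mod_cast hk)
  have hc2 : c < 2 := by nlinarith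
  have hk0 : (0 : ℝ) < k := by positivity
  have hstar : distSpecRad (starGraph (Fintype.card V) k) ≤ L - 1 :=
    distSpecRad_starGraph_le (by rw [hmk]) ha hc (by nlinarith) e₁.le e₂.le e₃.le
  obtain ⟨hle, heq⟩ := sq_sub_sq_le_of_distSpecRad_le (p := ((k - 2) * j + k : ℕ)) (q := q) hG hS
    hsurj hf (by rw [Fintype.card_fin, hι]; omega) (by exact_mod_cast hm)
    (by rw [Fintype.card_fin, hι]; push_cast; ring)
    (by rw [← hq]; have := hι; push_cast [← (by omega : (k - 2) * S.card + 2 = (k - 2) * j + k)]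
        ring) ha hc hc2 e₁ e₂ e₃ (hspec.trans hstar)
  rcases Nat.eq_zero_or_pos j with rfl | hj1
  · obtain ⟨hdist, l, hl⟩ := heq (by rw [hmq]; push_cast; ring)
    refine nonempty_iso_starGraph hj hsurj (by rw [Fintype.card_fin, hι]; ring) (fun u v => ?_) l hl
    rw [← SimpleGraph.dist_eq_one_iff_adj, hdist]
    unfold classDist
    split_ifs with h1 h2
    · simp [h1]
    · simpa using fun _ => h2
    · simp only [true_iff]
      exact ⟨h1, by tauto⟩
  · exfalso
    have hjr : (0 : ℝ) < j := by exact_mod_cast hj1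
    have hkr : ((k - 2 : ℕ) : ℝ) = k - 2 := by rw [Nat.cast_sub (by omega)]; norm_num
    have key : ((k : ℝ) - 2) * ((k - 2) * j + 2 * q) ≤ 2 * k * c + (k - 2) := by
      refine le_of_mul_le_mul_right ?_ hjr
      rw [hmq] at hle
      push_cast [hkr] at hle
      nlinarith
    have key' : (k - 2) * ((k - 2) * j + 2 * q) < 4 * k + (k - 2) := by
      have : ((k : ℝ) - 2) * ((k - 2) * j + 2 * q) < 4 * k + (k - 2) := by nlinarith
      rw [← hkr] at this
      exact_mod_cast this
    obtain ⟨rfl, ⟨rfl, rfl | rfl⟩ | ⟨rfl, rfl⟩⟩ := eq_of_mul_lt_of_five_le hk hj1 hq1 key'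
    · have h17 := lt_distSpecRad_of_nine_classes hG hj (by omega) (by simp [hj]) hsurj hf
      have : distSpecRad (starGraph (Fintype.card V) 5) ≤ 17 :=
        distSpecRad_starGraph_le (m := 5) (a := 10 / 14) (c := 17 / 14)
          (by rw [← hmk, hmq]; norm_num) (by norm_num) (by norm_num) (by norm_num) (by norm_num)
          (by norm_num) (by norm_num)
      linarith
    · norm_num [hmq] at key hcL hL
      nlinarith
    · norm_num [hmq] at key hcL hL
      nlinarith
end

section
/- Let G be a connected graph of order n with 6 ≤ n ≤ 11 and n ≡ 0 (mod 3). If λ₁(D(G)) ≤ λ₁(D(G♯)), where G♯ = K_{(n-3)/3} ∨ ((2n+3)/3)K₁, then G admits a spanning 4-tree, unless G is isomorphic to G♯. -/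
/-- A quadratic-form lower bound at a single vector bounds the distance spectral radius below. -/
lemma lt_distSpecRad_of_quadratic_form {V : Type*} [Fintype V] [DecidableEq V]
    (G : SimpleGraph V) (x : V → ℝ) (μ : ℝ)
    (hx : μ * ∑ v, x v ^ 2 < ∑ u, x u * ∑ v, (G.dist u v : ℝ) * x v) :
    μ < distSpecRad G := by
  by_contra! hμ
  have hsymm : (distMatrix G).IsHermitian := by
    ext u v
    simp [distMatrix, G.dist_comm]
  have hherm : (algebraMap ℝ (Matrix V V ℝ) (distSpecRad G) - distMatrix G).IsHermitian := by
    refine Matrix.IsHermitian.sub ?_ hsymm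
    ext u v
    simp [Matrix.algebraMap_matrix_apply, eq_comm]
  have hpsd : (algebraMap ℝ (Matrix V V ℝ) (distSpecRad G) - distMatrix G).PosSemidef := by
    rw [hherm.posSemidef_iff_eigenvalues_nonneg]
    intro i
    have hi := hherm.eigenvalues_mem_spectrum_real i
    rw [← spectrum.singleton_sub_eq] at hi
    obtain ⟨_, rfl, t, ht, hit⟩ := Set.mem_sub.mp hi
    have := le_csSup (distMatrix G).finite_real_spectrum.bddAbove ht
    change 0 ≤ hherm.eigenvalues i
    rw [← hit]
    exact sub_nonneg.mpr this
  have h := hpsd.dotProduct_mulVec_nonneg x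
  rw [Matrix.sub_mulVec, dotProduct_sub, Algebra.algebraMap_eq_smul_one, Matrix.smul_mulVec,
    Matrix.one_mulVec] at h
  simp only [dotProduct, Matrix.mulVec, distMatrix, Matrix.of_apply, Pi.star_apply, star_trivial,
    Pi.smul_apply, smul_eq_mul] at h
  have hsq : ∑ v, x v * (distSpecRad G * x v) = distSpecRad G * ∑ v, x v ^ 2 := by
    rw [Finset.mul_sum]
    exact Finset.sum_congr rfl fun v _ => by ring
  have := mul_le_mul_of_nonneg_right hμ (Finset.sum_nonneg fun v (_ : v ∈ Finset.univ) =>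
    sq_nonneg (x v))
  linarith

/-- A positive weight contracted by the distance matrix up to the factor `μ` shows that the
distance spectral radius is at most `μ`. -/
lemma distSpecRad_le_of_weight {V : Type*} [Fintype V] [DecidableEq V] [Nonempty V]
    (G : SimpleGraph V) (y : V → ℝ) (μ : ℝ) (hμ : 0 ≤ μ) (hy : ∀ v, 0 < y v)
    (h : ∀ u, ∑ v, (G.dist u v : ℝ) * y v ≤ μ * y u) :
    distSpecRad G ≤ μ := by
  refine Real.sSup_le (fun t ht => ?_) hμ
  rw [← Matrix.spectrum_toLin', ← Module.End.hasEigenvalue_iff_mem_spectrum] at ht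
  obtain ⟨w, hw⟩ := ht.exists_hasEigenvector
  obtain ⟨i, hi⟩ := Finite.exists_max fun v => |w v| / y v
  have hbound : ∀ v, |w v| ≤ |w i| / y i * y v := fun v => (div_le_iff₀ (hy v)).mp (hi v)
  have hpos : 0 < |w i| := by
    obtain ⟨v, hv⟩ := Function.ne_iff.mp hw.2
    by_contra! h0
    have h1 : |w i| = 0 := le_antisymm h0 (abs_nonneg _)
    have h2 := hbound v
    rw [h1] at h2
    simp only [zero_div, zero_mul] at h2
    exact hv (abs_nonpos_iff.mp h2)
  have heig : ∑ v, (G.dist i v : ℝ) * w v = t * w i := by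
    simpa [distMatrix, Matrix.mulVec, dotProduct] using congrFun hw.apply_eq_smul i
  have hle : t * |w i| ≤ μ * |w i| := calc
    t * |w i| ≤ |t * w i| := by
      rw [abs_mul]
      exact mul_le_mul_of_nonneg_right (le_abs_self t) (abs_nonneg _)
    _ = |∑ v, (G.dist i v : ℝ) * w v| := by rw [heig]
    _ ≤ ∑ v, |(G.dist i v : ℝ) * w v| := Finset.abs_sum_le_sum_abs _ _
    _ ≤ ∑ v, |w i| / y i * ((G.dist i v : ℝ) * y v) := Finset.sum_le_sum fun v _ => by
      rw [abs_mul, Nat.abs_cast, mul_left_comm]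
      exact mul_le_mul_of_nonneg_left (hbound v) (Nat.cast_nonneg _)
    _ = |w i| / y i * ∑ v, (G.dist i v : ℝ) * y v := by rw [Finset.mul_sum]
    _ ≤ |w i| / y i * (μ * y i) :=
      mul_le_mul_of_nonneg_left (h i) (div_nonneg hpos.le (hy i).le)
    _ = μ * |w i| := by field_simp [(hy i).ne']
  exact le_of_mul_le_mul_right hle hpos

/-- The distances in `K₂ ∨ 7K₁`. -/
noncomputable def sharpDist (u v : Fin 2 ⊕ Fin 7) : ℝ :=
  if u = v then 0 else if u.isLeft ∨ v.isLeft then 1 else 2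

/-- The Perron weight of `K₂ ∨ 7K₁`. -/
noncomputable def sharpWeight : Fin 2 ⊕ Fin 7 → ℝ :=
  Sum.elim (fun _ => 7) fun _ => (11 + √177) / 2

lemma sharpWeight_pos (u : Fin 2 ⊕ Fin 7) : 0 < sharpWeight u := by
  rcases u with i | i
  · norm_num [sharpWeight]
  · change 0 < (11 + √177) / 2
    positivity

lemma sum_sharpDist_mul_sharpWeight (u : Fin 2 ⊕ Fin 7) :
    ∑ v, sharpDist u v * sharpWeight v = (13 + √177) / 2 * sharpWeight u := by
  have h177 : √177 ^ 2 = 177 := Real.sq_sqrt (by norm_num)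
  rcases u with i | i <;> fin_cases i <;>
    simp [sharpDist, sharpWeight, Fin.sum_univ_succ] <;> nlinarith

lemma graphJoin_top_bot_adj {α β : Type*} (u v : α ⊕ β) :
    (graphJoin (⊤ : SimpleGraph α) (⊥ : SimpleGraph β)).Adj u v ↔
      u ≠ v ∧ (u.isLeft ∨ v.isLeft) := by
  rcases u with i | i <;> rcases v with j | j <;> simp [graphJoin]
  tauto

lemma sharpGraph_nine_adj (u v : Fin 2 ⊕ Fin 7) :
    (sharpGraph 9).Adj u v ↔ u ≠ v ∧ (u.isLeft ∨ v.isLeft) :=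
  graphJoin_top_bot_adj u v

lemma exists_equiv_fin_sum_fin {V : Type*} [Fintype V] [DecidableEq V] (S : Finset V) {a b : ℕ}
    (hS : S.card = a) (hV : Fintype.card V = a + b) :
    ∃ e : V ≃ Fin a ⊕ Fin b, ∀ v, (e v).isLeft ↔ v ∈ S := by
  have hp : Fintype.card {v // v ∈ S} = a := by simp [hS]
  have hnp : Fintype.card {v // ¬ v ∈ S} = b := by
    rw [Fintype.card_subtype_compl, hV, hp, Nat.add_sub_cancel_left]
  refine ⟨(Equiv.sumCompl (· ∈ S)).symm.trans
    (Equiv.sumCongr (Fintype.equivFinOfCardEq hp) (Fintype.equivFinOfCardEq hnp)), fun v => ?_⟩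
  by_cases hv : v ∈ S
  · simp [Equiv.sumCompl_symm_apply_of_pos (p := (· ∈ S)) hv, hv]
  · simp [Equiv.sumCompl_symm_apply_of_neg (p := (· ∈ S)) hv, hv]

/-- The distance spectral radius of `K₂ ∨ 7K₁` is at most `(13 + √177) / 2`. -/
lemma distSpecRad_sharpGraph_nine_le : distSpecRad (sharpGraph 9) ≤ (13 + √177) / 2 := by
  have hdist : ∀ u v : Fin 2 ⊕ Fin 7, ((sharpGraph 9).dist u v : ℝ) ≤ sharpDist u v := by
    intro u v
    unfold sharpDist
    split_ifs with h1 h2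
    · subst h1
      simp
    · rw [SimpleGraph.dist_eq_one_iff_adj.mpr ((sharpGraph_nine_adj u v).mpr ⟨h1, h2⟩)]
      simp
    · have hu : (sharpGraph 9).Adj u (.inl 0) :=
        (sharpGraph_nine_adj u (.inl 0)).mpr ⟨by rintro rfl; simp at h2, by simp⟩
      have hv : (sharpGraph 9).Adj (.inl 0) v :=
        (sharpGraph_nine_adj (.inl 0) v).mpr ⟨by rintro rfl; simp at h2, by simp⟩
      exact_mod_cast SimpleGraph.dist_le (.cons hu (.cons hv .nil))
  have : Nonempty (Fin ((9 - 3) / 3) ⊕ Fin ((2 * 9 + 3) / 3)) := ⟨.inl 0⟩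
  refine distSpecRad_le_of_weight _ sharpWeight _ (by positivity) sharpWeight_pos fun u => ?_
  rw [← sum_sharpDist_mul_sharpWeight]
  exact Finset.sum_le_sum fun v _ =>
    mul_le_mul_of_nonneg_right (hdist u v) (sharpWeight_pos v).le

/-- A connected graph whose edges all meet a fixed pair of vertices has distance spectral radius
larger than that of `K₂ ∨ 7K₁`, unless it is this graph. -/
lemma iso_sharpGraph_nine_of_distSpecRad_le {V : Type*} [Fintype V] [DecidableEq V]
    (G : SimpleGraph V) (hG : G.Connected) (hcard : Fintype.card V = 9) (c w : V) (hcw : c ≠ w)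
    (hcover : ∀ u v, G.Adj u v → u = c ∨ u = w ∨ v = c ∨ v = w)
    (hspec : distSpecRad G ≤ distSpecRad (sharpGraph 9)) :
    Nonempty (G ≃g sharpGraph 9) := by
  obtain ⟨e, he⟩ := exists_equiv_fin_sum_fin {c, w} (Finset.card_pair hcw) (b := 7) hcard
  simp only [Finset.mem_insert, Finset.mem_singleton] at he
  have hadj : ∀ u v, G.Adj u v → (sharpGraph 9).Adj (e u) (e v) := fun u v h =>
    (sharpGraph_nine_adj _ _).mpr ⟨e.injective.ne h.ne, by
      rw [he, he]
      have := hcover u v h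
      tauto⟩
  by_contra hiso
  obtain ⟨a, b, hab, hnab⟩ : ∃ a b, (sharpGraph 9).Adj (e a) (e b) ∧ ¬ G.Adj a b := by
    by_contra! h
    exact hiso ⟨⟨e, fun {u v} => ⟨h u v, hadj u v⟩⟩⟩
  have hdist : ∀ u v, sharpDist (e u) (e v) ≤ G.dist u v := by
    intro u v
    unfold sharpDist
    split_ifs with h1 h2
    · simp
    · exact_mod_cast hG.pos_dist_of_ne fun h => h1 (congrArg e h)
    · exact_mod_cast hG.one_lt_dist_of_ne_of_not_adj (fun h => h1 (congrArg e h))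
        fun h => h2 ((sharpGraph_nine_adj _ _).mp (hadj u v h)).2
  have hdist' : sharpDist (e a) (e b) < G.dist a b := by
    obtain ⟨h1, h2⟩ := (sharpGraph_nine_adj _ _).mp hab
    rw [sharpDist, if_neg h1, if_pos h2]
    exact_mod_cast hG.one_lt_dist_of_ne_of_not_adj (fun h => h1 (congrArg e h)) hnab
  refine absurd (hspec.trans distSpecRad_sharpGraph_nine_le) (not_le.mpr ?_)
  refine lt_distSpecRad_of_quadratic_form G (fun v => sharpWeight (e v)) _ ?_
  have hrow : ∀ u, (13 + √177) / 2 * sharpWeight (e u) =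
      ∑ v, sharpDist (e u) (e v) * sharpWeight (e v) := fun u => by
    rw [← sum_sharpDist_mul_sharpWeight, ← e.sum_comp]
  have hpos := fun v => sharpWeight_pos (e v)
  calc (13 + √177) / 2 * ∑ v, sharpWeight (e v) ^ 2
      = ∑ u, sharpWeight (e u) * ∑ v, sharpDist (e u) (e v) * sharpWeight (e v) := by
        rw [Finset.mul_sum]
        refine Finset.sum_congr rfl fun u _ => ?_
        rw [← hrow]
        ring
    _ < _ := by
        refine Finset.sum_lt_sum (fun u _ => ?_) ⟨a, Finset.mem_univ _, ?_⟩
        · exact mul_le_mul_of_nonneg_left (Finset.sum_le_sum fun v _ =>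
            mul_le_mul_of_nonneg_right (hdist u v) (hpos v).le) (hpos u).le
        · exact mul_lt_mul_of_pos_left (Finset.sum_lt_sum (fun v _ =>
            mul_le_mul_of_nonneg_right (hdist a v) (hpos v).le)
            ⟨b, Finset.mem_univ _, mul_lt_mul_of_pos_right hdist' (hpos b)⟩) (hpos a)

/-- If some vertex `c` and an independent set `R` of five vertices are such that each of the three
remaining vertices has at most one neighbour in `R`, then the distance spectral radius exceeds that
of `K₂ ∨ 7K₁`. -/
lemma distSpecRad_sharpGraph_nine_lt {V : Type*} [Fintype V] [DecidableEq V]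
    (G : SimpleGraph V) (hG : G.Connected) (hcard : Fintype.card V = 9) (c : V) (R : Finset V)
    (hR : R.card = 5) (hc : c ∉ R) (hindep : ∀ r ∈ R, ∀ s ∈ R, ¬ G.Adj r s)
    (hone : ∀ y, y ≠ c → y ∉ R → ∀ r ∈ R, ∀ s ∈ R, G.Adj y r → G.Adj y s → r = s) :
    distSpecRad (sharpGraph 9) < distSpecRad G := by
  refine distSpecRad_sharpGraph_nine_le.trans_lt ?_
  have h177 : √177 < 13.31 := by
    rw [Real.sqrt_lt' (by norm_num)]
    norm_num
  obtain ⟨Y, hY⟩ : ∃ Y, Y = (insert c R)ᶜ := ⟨_, rfl⟩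
  have hYcard : Y.card = 3 := by
    rw [hY, Finset.card_compl, Finset.card_insert_of_notMem hc, hcard, hR]
  have hcY : c ∉ Y := by simp [hY]
  have hRY : ∀ r ∈ R, r ∉ Y := fun r hr => by simp [hY, hr]
  have hYR : ∀ y ∈ Y, y ∉ R := fun y hy hyR => hRY y hyR hy
  have hne : ∀ r ∈ R, r ≠ c := fun r hr h => hc (h ▸ hr)
  have hneY : ∀ r ∈ Y, r ≠ c := fun r hr h => hcY (h ▸ hr)
  have hsum : ∀ f : V → ℝ, ∑ v, f v = f c + ∑ r ∈ R, f r + ∑ y ∈ Y, f y := fun f => by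
    rw [hY, ← Finset.sum_insert hc, Finset.sum_add_sum_compl]
  let x : V → ℝ := fun v => if v = c then 4 else if v ∈ R then 7 else 6
  have hxc : x c = 4 := if_pos rfl
  have hxR : ∀ r ∈ R, x r = 7 := fun r hr => by simp [x, hne r hr, hr]
  have hxY : ∀ y ∈ Y, x y = 6 := fun y hy => by simp [x, hneY y hy, hYR y hy]
  have hsumx : ∀ f : V → ℝ, ∑ v, f v * x v =
      4 * f c + 7 * ∑ r ∈ R, f r + 6 * ∑ y ∈ Y, f y := fun f => by
    rw [hsum, hxc, Finset.mul_sum, Finset.mul_sum]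
    congr 1
    · congr 1
      · ring
      · exact Finset.sum_congr rfl fun r hr => by rw [hxR r hr]; ring
    · exact Finset.sum_congr rfl fun r hr => by rw [hxY r hr]; ring
  have hd1 : ∀ u v, u ≠ v → (1 : ℝ) ≤ G.dist u v := fun u v h => by
    exact_mod_cast hG.pos_dist_of_ne h
  have hd2 : ∀ u v, u ≠ v → ¬ G.Adj u v → (2 : ℝ) ≤ G.dist u v := fun u v h h' => by
    exact_mod_cast hG.one_lt_dist_of_ne_of_not_adj h h'
  have hlow : ∀ (S : Finset V) (f : V → ℝ) (m : ℝ), (∀ s ∈ S, m ≤ f s) →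
      S.card * m ≤ ∑ s ∈ S, f s := fun S f m h => by
    rw [← nsmul_eq_mul]
    exact Finset.card_nsmul_le_sum _ _ _ h
  have hlow' : ∀ (S : Finset V) (f : V → ℝ) (m : ℝ) (t : V), t ∈ S → 0 ≤ f t →
      (∀ s ∈ S, s ≠ t → m ≤ f s) → (S.card - 1) * m ≤ ∑ s ∈ S, f s := fun S f m t ht h0 h => by
    rw [← Finset.add_sum_erase S f ht]
    have := hlow (S.erase t) f m fun s hs =>
      h s (Finset.mem_of_mem_erase hs) (Finset.ne_of_mem_erase hs)
    rw [Finset.card_erase_of_mem ht, Nat.cast_sub (Finset.card_pos.mpr ⟨t, ht⟩)] at this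
    push_cast at this
    linarith
  have hYd : ∀ y ∈ Y, 9 ≤ ∑ r ∈ R, (G.dist y r : ℝ) := by
    intro y hy
    by_cases hex : ∃ r ∈ R, G.Adj y r
    · obtain ⟨r, hr, hyr⟩ := hex
      rw [← Finset.add_sum_erase R _ hr]
      have h1 := hd1 y r hyr.ne
      have h2 := hlow (R.erase r) (fun s => (G.dist y s : ℝ)) 2 fun s hs =>
        hd2 y s (fun h => hYR y hy (h ▸ Finset.mem_of_mem_erase hs)) fun h =>
          Finset.ne_of_mem_erase hs
            (hone y (hneY y hy) (hYR y hy) s (Finset.mem_of_mem_erase hs) r hr h hyr)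
      rw [Finset.card_erase_of_mem hr, hR] at h2
      norm_num at h2
      linarith
    · push Not at hex
      have h2 := hlow R (fun s => (G.dist y s : ℝ)) 2 fun s hs =>
        hd2 y s (fun h => hYR y hy (h ▸ hs)) (hex s hs)
      rw [hR] at h2
      norm_num at h2
      linarith
  have hrowc : 53 ≤ ∑ v, (G.dist c v : ℝ) * x v := by
    rw [hsumx]
    have h1 := hlow R (fun s => (G.dist c s : ℝ)) 1 fun s hs => hd1 c s (hne s hs).symm
    have h2 := hlow Y (fun s => (G.dist c s : ℝ)) 1 fun s hs => hd1 c s (hneY s hs).symm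
    rw [hR] at h1
    rw [hYcard] at h2
    norm_num at h1 h2 ⊢
    linarith
  have hrowR : ∀ r ∈ R, 60 + 6 * ∑ y ∈ Y, (G.dist r y : ℝ) ≤ ∑ v, (G.dist r v : ℝ) * x v := by
    intro r hr
    rw [hsumx]
    have h1 := hlow' R (fun s => (G.dist r s : ℝ)) 2 r hr (by simp) fun s hs hsr =>
      hd2 r s hsr.symm (hindep r hr s hs)
    have h2 := hd1 r c (hne r hr)
    rw [hR] at h1
    norm_num at h1
    linarith
  have hrowY : ∀ y ∈ Y, 79 ≤ ∑ v, (G.dist y v : ℝ) * x v := by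
    intro y hy
    rw [hsumx]
    have h1 := hlow' Y (fun s => (G.dist y s : ℝ)) 1 y hy (by simp) fun s hs hsr =>
      hd1 y s hsr.symm
    have h2 := hd1 y c (hneY y hy)
    have h3 := hYd y hy
    rw [hYcard] at h1
    norm_num at h1
    linarith
  refine lt_distSpecRad_of_quadratic_form G x _ ?_
  have hsq : ∑ v, x v ^ 2 = 369 := by
    simp only [sq, hsumx, hxc]
    rw [Finset.sum_congr rfl hxR, Finset.sum_congr rfl hxY]
    norm_num [hR, hYcard]
  have hRsum := Finset.sum_le_sum hrowR
  rw [Finset.sum_add_distrib, ← Finset.mul_sum, Finset.sum_comm] at hRsum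
  have hswap : 27 ≤ ∑ y ∈ Y, ∑ r ∈ R, (G.dist r y : ℝ) := by
    have := hlow Y (fun y => ∑ r ∈ R, (G.dist r y : ℝ)) 9 fun y hy => by
      simpa only [G.dist_comm] using hYd y hy
    rw [hYcard] at this
    norm_num at this
    exact this
  have hYsum := hlow Y _ 79 hrowY
  rw [hYcard] at hYsum
  simp only [Finset.sum_const, hR, nsmul_eq_mul] at hRsum
  simp only [mul_comm (x _), hsumx fun u => ∑ v, (G.dist u v : ℝ) * x v, hsq]
  norm_num at hRsum hYsum h177 ⊢
  linarith

section SpanningTrees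

variable {V : Type*}

lemma forall_of_forall_adj {T : SimpleGraph V} (hT : T.Connected) {P : V → Prop} {a : V}
    (ha : P a) (h : ∀ x y, P x → T.Adj x y → P y) (x : V) : P x := by
  have := (SimpleGraph.reachable_iff_reflTransGen a x).mp (hT.preconnected a x)
  induction this with
  | refl => exact ha
  | tail _ hxy ih => exact h _ _ ih hxy

/-- A tree in which all vertices but `c` and `w` are leaves is a double star. -/
lemma double_star_of_degrees {T : SimpleGraph V} (hT : T.Connected) {c w : V} (hcw : c ≠ w)
    (hleaf : ∀ z, z ≠ c → z ≠ w → (T.neighborSet z).ncard = 1) :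
    T.Adj c w ∧ (∀ z, z ≠ c → z ≠ w → T.Adj c z ∨ T.Adj w z) ∧
      ∀ z, z ≠ c → z ≠ w → T.Adj c z → ¬ T.Adj w z := by
  have huniq : ∀ z, z ≠ c → z ≠ w → ∃ y, ∀ x, T.Adj z x ↔ x = y := fun z hzc hzw => by
    obtain ⟨y, hy⟩ := Set.ncard_eq_one.mp (hleaf z hzc hzw)
    exact ⟨y, fun x => by rw [← SimpleGraph.mem_neighborSet, hy, Set.mem_singleton_iff]⟩
  refine ⟨?_, fun z hzc hzw => ?_, fun z hzc hzw h1 h2 => ?_⟩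
  · by_contra hn
    have key := forall_of_forall_adj hT (P := fun x => x = c ∨ T.Adj c x) (a := c) (.inl rfl)
      (fun x y hx hxy => by
        rcases hx with rfl | hx
        · exact .inr hxy
        · obtain ⟨t, ht⟩ := huniq x hx.ne' (by rintro rfl; exact hn hx)
          exact .inl (((ht y).mp hxy).trans ((ht c).mp hx.symm).symm)) w
    exact key.elim (fun h => hcw h.symm) hn
  · by_contra! hn
    obtain ⟨y, hy⟩ := huniq z hzc hzw
    have hzy : T.Adj z y := (hy y).mpr rfl
    obtain ⟨t, ht⟩ := huniq y (by rintro rfl; exact hn.1 hzy.symm)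
      (by rintro rfl; exact hn.2 hzy.symm)
    have htz : z = t := (ht z).mp hzy.symm
    have key := forall_of_forall_adj hT (P := fun x => x = z ∨ x = y) (a := z) (.inl rfl)
      fun x x' hx hxx' => by
        rcases hx with rfl | rfl
        · exact .inr ((hy x').mp hxx')
        · exact .inl (((ht x').mp hxx').trans htz.symm)
    rcases key c with h | h
    · exact hzc h.symm
    · exact hn.1 (h ▸ hzy.symm)
  · obtain ⟨y, hy⟩ := huniq z hzc hzw
    exact hcw (((hy c).mp h1.symm).trans ((hy w).mp h2.symm).symm)

variable [Fintype V]

lemma one_le_ncard_neighborSet {T : SimpleGraph V} (hT : T.Connected)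
    (hV : 1 < Fintype.card V) (v : V) : 1 ≤ (T.neighborSet v).ncard := by
  have := Fintype.one_lt_card_iff_nontrivial.mp hV
  obtain ⟨w, hw⟩ := hT.preconnected.exists_adj_of_nontrivial v
  exact (Set.ncard_pos (Set.toFinite _)).mpr ⟨w, hw⟩

lemma sum_ncard_neighborSet_of_isTree {T : SimpleGraph V} (hT : T.IsTree) :
    ∑ v, (T.neighborSet v).ncard + 2 = 2 * Fintype.card V := by
  classical
  have h : ∀ v, (T.neighborSet v).ncard = T.degree v := fun v => by
    rw [Set.ncard_eq_toFinset_card', SimpleGraph.degree, SimpleGraph.neighborFinset]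
  rw [Finset.sum_congr rfl fun v _ => h v, T.sum_degrees_eq_twice_card_edges,
    ← hT.card_edgeFinset]
  ring

/-- Among the terms of a sum of positive integers, any three contribute at most the total minus the
number of the remaining ones. -/
lemma sum_ge_of_one_le [DecidableEq V] (f : V → ℕ) (hf : ∀ v, 1 ≤ f v) (c x : V) (hcx : c ≠ x) :
    f c + f x + (Fintype.card V - 2) ≤ ∑ v, f v ∧
      ∀ z, z ≠ c → z ≠ x → f c + f x + f z + (Fintype.card V - 3) ≤ ∑ v, f v := by
  have hxc : x ∈ Finset.univ.erase c := by simp [hcx.symm]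
  have hlow : ∀ S : Finset V, S.card ≤ ∑ v ∈ S, f v := fun S => by
    simpa using Finset.card_nsmul_le_sum S f 1 fun v _ => hf v
  have hcard : ((Finset.univ.erase c).erase x).card = Fintype.card V - 2 := by
    rw [Finset.card_erase_of_mem hxc, Finset.card_erase_of_mem (Finset.mem_univ _),
      Finset.card_univ]
    omega
  rw [← Finset.add_sum_erase _ f (Finset.mem_univ c), ← Finset.add_sum_erase _ f hxc]
  refine ⟨?_, fun z hzc hzx => ?_⟩
  · have := hlow ((Finset.univ.erase c).erase x)
    omega
  · have hz : z ∈ (Finset.univ.erase c).erase x := by simp [hzc, hzx]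
    rw [← Finset.add_sum_erase _ f hz]
    have := hlow (((Finset.univ.erase c).erase x).erase z)
    rw [Finset.card_erase_of_mem hz] at this
    omega

lemma hasSpanningKTree_of_connected {G H : SimpleGraph V} {k : ℕ} (hHG : H ≤ G)
    (hH : H.Connected) (hdeg : ∀ v, (H.neighborSet v).ncard ≤ k) : HasSpanningKTree G k := by
  obtain ⟨T, hTH, hT⟩ := hH.exists_isTree_le
  exact ⟨T, hTH.trans hHG, hT, fun v =>
    (Set.ncard_le_ncard fun w (hw : T.Adj v w) => hTH hw).trans (hdeg v)⟩

/-- A graph without a spanning `k`-tree has a spanning tree of least possible maximum degree, which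
exceeds `k` and is attained at some vertex `c`. -/
lemma exists_isTree_min_degree {G : SimpleGraph V} (hG : G.Connected) {k : ℕ}
    (hk : ¬ HasSpanningKTree G k) :
    ∃ T ≤ G, T.IsTree ∧ ∃ c, k < (T.neighborSet c).ncard ∧
      ∀ H ≤ G, H.Connected → ∃ x, (T.neighborSet c).ncard ≤ (H.neighborSet x).ncard := by
  classical
  have hex : ∃ d, HasSpanningKTree G d := ⟨Fintype.card V, hasSpanningKTree_of_connected le_rfl hG
    fun v => (Set.ncard_le_card _).trans_eq Nat.card_eq_fintype_card⟩
  obtain ⟨T, hTG, hT, hdeg⟩ := Nat.find_spec hex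
  have hlt : ∀ d < Nat.find hex, ∀ H ≤ G, H.Connected → ∃ x, d < (H.neighborSet x).ncard := by
    intro d hd H hHG hH
    by_contra! h
    exact Nat.find_min hex hd (hasSpanningKTree_of_connected hHG hH h)
  have hkd : k < Nat.find hex := by
    by_contra! h
    exact hk ⟨T, hTG, hT, fun v => (hdeg v).trans h⟩
  obtain ⟨c, hc⟩ := hlt (Nat.find hex - 1) (by omega) T hTG hT.connected
  have hc' : (T.neighborSet c).ncard = Nat.find hex := le_antisymm (hdeg c) (by omega)
  refine ⟨T, hTG, hT, c, by omega, fun H hHG hH => ?_⟩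
  obtain ⟨x, hx⟩ := hlt (Nat.find hex - 1) (by omega) H hHG hH
  exact ⟨x, by omega⟩

/-- Replacing the edge `cr` of a tree by an edge `uv` reconnecting the two sides. -/
lemma exists_connected_exchange {G T : SimpleGraph V} (hTG : T ≤ G) (hT : T.IsTree) {c r u v : V}
    (hcr : T.Adj c r) (hu : (T.deleteEdges {s(c, r)}).Reachable r u)
    (hv : ¬ (T.deleteEdges {s(c, r)}).Reachable r v) (hvc : v ≠ c) (huv : G.Adj u v) :
    ∃ H ≤ G, H.Connected ∧ (H.neighborSet c).ncard < (T.neighborSet c).ncard ∧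
      ∀ x, (H.neighborSet x).ncard ≤ (T.neighborSet x).ncard + 1 := by
  classical
  have hbridge : ¬ (T.deleteEdges {s(c, r)}).Reachable c r :=
    SimpleGraph.isBridge_iff.mp
      (SimpleGraph.isAcyclic_iff_forall_adj_isBridge.mp hT.isAcyclic hcr)
  have huc : u ≠ c := fun h => hbridge (h ▸ hu).symm
  have hside : ∀ x, (T.deleteEdges {s(c, r)}).Reachable r x ∨
      (T.deleteEdges {s(c, r)}).Reachable c x := by
    refine forall_of_forall_adj hT.connected (a := c) (.inr .rfl) fun x y hx hxy => ?_
    by_cases hxy' : s(x, y) = s(c, r)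
    · rcases Sym2.eq_iff.mp hxy' with ⟨-, rfl⟩ | ⟨-, rfl⟩
      exacts [.inl .rfl, .inr .rfl]
    · have h : (T.deleteEdges {s(c, r)}).Adj x y := by
        simpa [SimpleGraph.deleteEdges_adj] using ⟨hxy, by simpa using hxy'⟩
      exact hx.imp (·.trans h.reachable) (·.trans h.reachable)
  let H : SimpleGraph V := T.deleteEdges {s(c, r)} ⊔ SimpleGraph.edge u v
  have hle : T.deleteEdges {s(c, r)} ≤ H := le_sup_left
  have hHuv : H.Adj u v := by simp [H, SimpleGraph.edge_adj, huv.ne]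
  have hHadj : ∀ {x y}, H.Adj x y →
      (T.Adj x y ∧ s(x, y) ≠ s(c, r)) ∨ (x = u ∧ y = v) ∨ (x = v ∧ y = u) := by
    intro x y h
    simp only [H, SimpleGraph.sup_adj, SimpleGraph.deleteEdges_adj, SimpleGraph.edge_adj,
      Set.mem_singleton_iff] at h
    tauto
  refine ⟨H, fun x y h => ?_, ?_, ?_, fun x => ?_⟩
  · rcases hHadj h with h | ⟨rfl, rfl⟩ | ⟨rfl, rfl⟩
    exacts [hTG h.1, huv, huv.symm]
  · have hcv : H.Reachable c v := ((hside v).resolve_left hv).mono hle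
    have hrc : H.Reachable c r := (hcv.trans hHuv.symm.reachable).trans (hu.mono hle).symm
    exact SimpleGraph.connected_iff_exists_forall_reachable _ |>.mpr ⟨c, fun x =>
      (hside x).elim (fun h => hrc.trans (h.mono hle)) fun h => h.mono hle⟩
  · refine Set.ncard_lt_ncard (Set.ssubset_iff_of_subset (fun y hy => ?_) |>.mpr
      ⟨r, hcr, fun hy => ?_⟩)
    · rcases hHadj hy with h | ⟨h, -⟩ | ⟨h, -⟩
      exacts [h.1, absurd h.symm huc, absurd h.symm hvc]
    · rcases hHadj hy with h | ⟨h, -⟩ | ⟨h, -⟩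
      exacts [h.2 rfl, huc h.symm, hvc h.symm]
  · refine le_trans (Set.ncard_le_ncard (t := insert (if x = u then v else u) (T.neighborSet x))
      fun y hy => ?_) (Set.ncard_insert_le _ _)
    rcases hHadj hy with h | ⟨rfl, rfl⟩ | ⟨rfl, rfl⟩
    · exact .inr h.1
    · simp
    · simp [huv.ne']

/-- Two adjacent hubs with three neighbours each and one further vertex, pendant at one of these
neighbours, form a spanning `4`-tree. -/
lemma hasSpanningKTree_four_of_two_hubs [DecidableEq V] {G : SimpleGraph V} {c w l m : V}
    {A B : Finset V} (hcw : G.Adj c w) (hA : ∀ a ∈ A, G.Adj c a) (hB : ∀ b ∈ B, G.Adj w b)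
    (hAcard : A.card ≤ 3) (hBcard : B.card ≤ 3) (hwA : w ∉ A) (hcB : c ∉ B)
    (hlc : l ≠ c) (hlw : l ≠ w) (hlA : l ∉ A) (hlB : l ∉ B) (hm : m ∈ A ∪ B) (hlm : G.Adj l m)
    (hcover : ∀ x, x = c ∨ x = w ∨ x = l ∨ x ∈ A ∨ x ∈ B) :
    HasSpanningKTree G 4 := by
  let p : V → V := fun x => if x = c then c else if x = w then c else if x ∈ A then c else
    if x ∈ B then w else m
  have hcA : c ∉ A := fun h => (hA c h).ne rfl
  have hwB : w ∉ B := fun h => (hB w h).ne rfl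
  have hwc : w ≠ c := hcw.ne'
  have hpc : p c = c := by simp [p]
  have hpw : p w = c := by simp [p]
  have hpA : ∀ a ∈ A, p a = c := fun a ha => by simp [p, ha]
  have hpB : ∀ b ∈ B, p b = c ∨ p b = w := fun b hb => by
    by_cases b ∈ A <;> grind
  have hpl : p l = m := by simp [p, hlc, hlw, hlA, hlB]
  let H : SimpleGraph V := SimpleGraph.fromRel fun x y => y = p x
  have hHadj : ∀ {x y}, H.Adj x y ↔ x ≠ y ∧ (y = p x ∨ x = p y) := SimpleGraph.fromRel_adj _ _ _
  have hpG : ∀ x, x ≠ p x → G.Adj x (p x) := by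
    intro x hx
    rcases hcover x with rfl | rfl | rfl | h | h
    · exact absurd hpc.symm hx
    · rw [hpw]; exact hcw.symm
    · rw [hpl]; exact hlm
    · rw [hpA x h]; exact (hA x h).symm
    · by_cases hxA : x ∈ A
      · rw [hpA x hxA]; exact (hA x hxA).symm
      · have : p x = w := by grind
        rw [this]; exact (hB x h).symm
  have hpreach : ∀ x, H.Reachable x (p x) := fun x => by
    by_cases hx : x = p x
    · rw [← hx]
    · exact (hHadj.mpr ⟨hx, .inl rfl⟩).reachable
  have hreach : ∀ x, H.Reachable x c := by
    have hw : H.Reachable w c := hpw ▸ hpreach w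
    have hAr : ∀ x ∈ A, H.Reachable x c := fun x hx => hpA x hx ▸ hpreach x
    have hBr : ∀ x ∈ B, H.Reachable x c := fun x hx => by
      rcases hpB x hx with h | h
      · exact h ▸ hpreach x
      · exact (h ▸ hpreach x).trans hw
    intro x
    rcases hcover x with rfl | rfl | rfl | h | h
    · exact .rfl
    · exact hw
    · exact (hpl ▸ hpreach x).trans ((Finset.mem_union.mp hm).elim (hAr m) (hBr m))
    · exact hAr x h
    · exact hBr x h
  refine hasSpanningKTree_of_connected (H := H) (fun x y h => ?_)
    (SimpleGraph.connected_iff_exists_forall_reachable _ |>.mpr ⟨c, fun x => (hreach x).symm⟩)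
    fun x => ?_
  · obtain ⟨hne, rfl | rfl⟩ := hHadj.mp h
    exacts [hpG _ hne, (hpG _ hne.symm).symm]
  · have hbound : ∀ S : Finset V, S.card ≤ 4 → H.neighborSet x ⊆ S →
        (H.neighborSet x).ncard ≤ 4 := fun S hS h =>
      (Set.ncard_le_ncard h).trans (by rwa [Set.ncard_coe_finset])
    have hmc : m ≠ c := by grind
    have hmw : m ≠ w := by grind
    by_cases hxc : x = c
    · refine hbound (insert w A) ((Finset.card_insert_le _ _).trans (by omega)) fun y hy => ?_
      have := hHadj.mp hy
      have := hcover y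
      simp only [Finset.coe_insert, Set.mem_insert_iff, Finset.mem_coe]
      grind
    by_cases hxw : x = w
    · refine hbound (insert c B) ((Finset.card_insert_le _ _).trans (by omega)) fun y hy => ?_
      have := hHadj.mp hy
      have := hcover y
      simp only [Finset.coe_insert, Set.mem_insert_iff, Finset.mem_coe]
      grind
    · refine hbound {p x, l} (Finset.card_le_two.trans (by omega)) fun y hy => ?_
      have := hHadj.mp hy
      have := hcover y
      simp only [Finset.coe_insert, Set.mem_insert_iff, Finset.coe_singleton,
        Set.mem_singleton_iff]
      grind

/-- If a spanning tree of least maximum degree at least `5` on at most nine vertices admits an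
exchange at its vertex `c` of maximum degree, then it is a double star with hub degrees `5` and
`4`. -/
lemma degrees_of_exchange [DecidableEq V] {G T : SimpleGraph V} (hTG : T ≤ G) (hT : T.IsTree)
    (hcard : Fintype.card V ≤ 9) {c r u v : V} (hc : 4 < (T.neighborSet c).ncard)
    (hmin : ∀ H ≤ G, H.Connected → ∃ x, (T.neighborSet c).ncard ≤ (H.neighborSet x).ncard)
    (hcr : T.Adj c r) (hu : (T.deleteEdges {s(c, r)}).Reachable r u)
    (hv : ¬ (T.deleteEdges {s(c, r)}).Reachable r v) (hvc : v ≠ c) (huv : G.Adj u v) :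
    Fintype.card V = 9 ∧ (T.neighborSet c).ncard = 5 ∧
      ∃ w, c ≠ w ∧ (T.neighborSet w).ncard = 4 ∧
        ∀ z, z ≠ c → z ≠ w → (T.neighborSet z).ncard = 1 := by
  obtain ⟨H, hHG, hH, hHc, hHx⟩ := exists_connected_exchange hTG hT hcr hu hv hvc huv
  obtain ⟨x, hx⟩ := hmin H hHG hH
  have hcx : c ≠ x := by
    rintro rfl
    omega
  have hV : 1 < Fintype.card V := Fintype.one_lt_card_iff.mpr ⟨c, x, hcx⟩
  have hpos := one_le_ncard_neighborSet hT.connected hV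
  have hsum := sum_ncard_neighborSet_of_isTree hT
  obtain ⟨h2, h3⟩ := sum_ge_of_one_le _ hpos c x hcx
  have := hHx x
  refine ⟨by omega, by omega, x, hcx, by omega, fun z hzc hzx => ?_⟩
  have := h3 z hzc hzx
  have := hpos z
  omega

/-- If no exchange is possible at the vertex `c` of the spanning tree `T`, then the neighbours of
`c` in `T` lie in distinct components of `G - c`. -/
lemma neighbors_separated_of_no_exchange {G T : SimpleGraph V} (hT : T.IsTree) {c : V}
    (hno : ∀ r u v, T.Adj c r → (T.deleteEdges {s(c, r)}).Reachable r u →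
      ¬ (T.deleteEdges {s(c, r)}).Reachable r v → v ≠ c → ¬ G.Adj u v)
    {r s : V} (hr : T.Adj c r) (hs : T.Adj c s) (hrs : r ≠ s) :
    ¬ G.Adj r s ∧ ∀ y, y ≠ c → G.Adj y r → ¬ G.Adj y s := by
  have hbridge : ¬ (T.deleteEdges {s(c, r)}).Reachable c r :=
    SimpleGraph.isBridge_iff.mp
      (SimpleGraph.isAcyclic_iff_forall_adj_isBridge.mp hT.isAcyclic hr)
  have hcs : (T.deleteEdges {s(c, r)}).Adj c s := by
    simp [SimpleGraph.deleteEdges_adj, hs, hrs.symm, hs.ne']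
  have hs' : ¬ (T.deleteEdges {s(c, r)}).Reachable r s := fun h =>
    hbridge (hcs.reachable.trans h.symm)
  refine ⟨hno r r s hr .rfl hs' hs.ne', fun y hyc hyr => ?_⟩
  by_cases hy : (T.deleteEdges {s(c, r)}).Reachable r y
  · exact hno r y s hr hy hs' hs.ne'
  · exact absurd hyr.symm (hno r r y hr .rfl hy hyc)

/-- A graph on nine vertices without a spanning `4`-tree is either covered by two vertices or
has a vertex whose deletion leaves at least five components, represented here by `R`. -/
lemma structure_of_not_hasSpanningKTree_four [DecidableEq V] {G : SimpleGraph V}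
    (hG : G.Connected) (hcard : Fintype.card V = 9) (hno : ¬ HasSpanningKTree G 4) :
    (∃ c w, c ≠ w ∧ ∀ u v, G.Adj u v → u = c ∨ u = w ∨ v = c ∨ v = w) ∨
    ∃ c, ∃ R : Finset V, R.card = 5 ∧ c ∉ R ∧ (∀ r ∈ R, ∀ s ∈ R, ¬ G.Adj r s) ∧
      ∀ y, y ≠ c → y ∉ R → ∀ r ∈ R, ∀ s ∈ R, G.Adj y r → G.Adj y s → r = s := by
  classical
  obtain ⟨T, hTG, hT, c, hc, hmin⟩ := exists_isTree_min_degree hG hno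
  by_cases hex : ∀ r u v, T.Adj c r → (T.deleteEdges {s(c, r)}).Reachable r u →
      ¬ (T.deleteEdges {s(c, r)}).Reachable r v → v ≠ c → ¬ G.Adj u v
  · right
    have hsep := fun {r s} => neighbors_separated_of_no_exchange hT hex (r := r) (s := s)
    rw [Set.ncard_eq_toFinset_card'] at hc
    obtain ⟨R, hRsub, hR⟩ := Finset.exists_subset_card_eq (Nat.succ_le_of_lt hc)
    have hadj : ∀ r ∈ R, T.Adj c r := fun r hr => by simpa using hRsub hr
    refine ⟨c, R, hR, fun h => (hadj c h).ne rfl, fun r hr s hs hrs => ?_,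
      fun y hyc _ r hr s hs hyr hys => ?_⟩
    · exact (hsep (hadj r hr) (hadj s hs) hrs.ne).1 hrs
    · by_contra hrs
      exact (hsep (hadj r hr) (hadj s hs) hrs).2 y hyc hyr hys
  push Not at hex
  obtain ⟨r, u, v, hcr, hu, hv, hvc, huv⟩ := hex
  obtain ⟨-, hc5, w, hcw, hw4, hleaf⟩ :=
    degrees_of_exchange hTG hT hcard.le hc hmin hcr hu hv hvc huv
  obtain ⟨hTcw, hcov, hdisj⟩ := double_star_of_degrees hT.connected hcw hleaf
  obtain ⟨A, hA⟩ : ∃ A, A = (T.neighborFinset c).erase w := ⟨_, rfl⟩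
  obtain ⟨B, hB⟩ : ∃ B, B = (T.neighborFinset w).erase c := ⟨_, rfl⟩
  have hAcard : A.card = 4 := by
    rw [hA, Finset.card_erase_of_mem (by simpa using hTcw), SimpleGraph.neighborFinset,
      ← Set.ncard_eq_toFinset_card', hc5]
  have hBcard : B.card = 3 := by
    rw [hB, Finset.card_erase_of_mem (by simpa using hTcw.symm), SimpleGraph.neighborFinset,
      ← Set.ncard_eq_toFinset_card', hw4]
  have hmA : ∀ x, x ∈ A ↔ x ≠ w ∧ T.Adj c x := fun x => by simp [hA]
  have hmB : ∀ x, x ∈ B ↔ x ≠ c ∧ T.Adj w x := fun x => by simp [hB]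
  have hcA : c ∉ A := fun h => ((hmA c).mp h).2.ne rfl
  have hwB : w ∉ B := fun h => ((hmB w).mp h).2.ne rfl
  have hwA : w ∉ A := by simp [hA]
  have hcB : c ∉ B := by simp [hB]
  have hAB : ∀ x ∈ A, x ∉ B := fun x hxA hxB =>
    hdisj x ((hmB x).mp hxB).1 ((hmA x).mp hxA).1 ((hmA x).mp hxA).2 ((hmB x).mp hxB).2
  have hGA : ∀ a ∈ A, G.Adj c a := fun a ha => hTG ((hmA a).mp ha).2
  have hGB : ∀ b ∈ B, G.Adj w b := fun b hb => hTG ((hmB b).mp hb).2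
  have hcover : ∀ x, x = c ∨ x = w ∨ x ∈ A ∨ x ∈ B := fun x => by
    have := hcov x
    have := hmA x
    have := hmB x
    tauto
  have hAfree : ∀ l ∈ A, ∀ m, m ∈ A ∨ m ∈ B → ¬ G.Adj l m := fun l hl m hm hlm =>
    hno <| hasSpanningKTree_four_of_two_hubs (hTG hTcw) (l := l) (m := m) (A := A.erase l)
      (B := B) (fun a ha => hGA a (Finset.mem_of_mem_erase ha)) hGB
      (by rw [Finset.card_erase_of_mem hl, hAcard]) hBcard.le
      (fun h => hwA (Finset.mem_of_mem_erase h)) hcB (fun h => hcA (h ▸ hl))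
      (fun h => hwA (h ▸ hl)) (by simp) (hAB l hl)
      (by simpa [hlm.ne'] using hm) hlm
      fun x => by
        have := hcover x
        simp only [Finset.mem_erase]
        tauto
  by_cases hwv : ∃ v ∈ A, G.Adj w v
  · left
    obtain ⟨v, hv, hwv⟩ := hwv
    have hBfree : ∀ l ∈ B, ∀ m ∈ B, ¬ G.Adj l m := fun l hl m hm hlm =>
      hno <| hasSpanningKTree_four_of_two_hubs (hTG hTcw) (l := l) (m := m) (A := A.erase v)
        (B := insert v (B.erase l)) (fun a ha => hGA a (Finset.mem_of_mem_erase ha))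
        (fun b hb => by
          rcases Finset.mem_insert.mp hb with rfl | hb
          exacts [hwv, hGB b (Finset.mem_of_mem_erase hb)])
        (by rw [Finset.card_erase_of_mem hv, hAcard])
        ((Finset.card_insert_le _ _).trans (by rw [Finset.card_erase_of_mem hl, hBcard]))
        (fun h => hwA (Finset.mem_of_mem_erase h)) (by grind) (fun h => hcB (h ▸ hl))
        (fun h => hwB (h ▸ hl)) (by grind) (by grind) (by simp [hlm.ne', hm]) hlm
        fun x => by
          have := hcover x
          simp only [Finset.mem_erase, Finset.mem_insert]
          tauto
    refine ⟨c, w, hcw, fun x y hxy => ?_⟩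
    by_contra! h
    obtain ⟨h1, h2, h3, h4⟩ := h
    have hx : x ∈ A ∨ x ∈ B := by simpa [h1, h2] using hcover x
    have hy : y ∈ A ∨ y ∈ B := by simpa [h3, h4] using hcover y
    rcases hx with hx | hx
    · exact hAfree x hx y hy hxy
    rcases hy with hy | hy
    · exact hAfree y hy x (.inr hx) hxy.symm
    · exact hBfree x hx y hy hxy
  · right
    push Not at hwv
    refine ⟨c, insert w A, by rw [Finset.card_insert_of_notMem hwA, hAcard],
      by simp [hcw, hcA], fun x hx y hy hxy => ?_, fun y hyc hyR r hr s hs hyr hys => ?_⟩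
    · rcases Finset.mem_insert.mp hx with rfl | hxA <;>
        rcases Finset.mem_insert.mp hy with rfl | hyA
      exacts [hxy.ne rfl, hwv y hyA hxy, hwv x hxA hxy.symm, hAfree x hxA y (.inl hyA) hxy]
    · have hyB : y ∈ B := by
        have := hcover y
        grind
      have hw : ∀ t ∈ insert w A, G.Adj y t → t = w := fun t ht hyt =>
        (Finset.mem_insert.mp ht).resolve_right fun h => hAfree t h y (.inr hyB) hyt.symm
      rw [hw r hr hyr, hw s hs hys]

/-- A graph on six vertices without a spanning `4`-tree is a star. -/
lemma star_of_not_hasSpanningKTree_four [DecidableEq V] {G : SimpleGraph V}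
    (hG : G.Connected) (hcard : Fintype.card V = 6) (hno : ¬ HasSpanningKTree G 4) :
    ∃ c, ∀ u v, G.Adj u v ↔ u ≠ v ∧ (u = c ∨ v = c) := by
  classical
  obtain ⟨T, hTG, hT, c, hc, hmin⟩ := exists_isTree_min_degree hG hno
  have hex : ∀ r u v, T.Adj c r → (T.deleteEdges {s(c, r)}).Reachable r u →
      ¬ (T.deleteEdges {s(c, r)}).Reachable r v → v ≠ c → ¬ G.Adj u v :=
    fun r u v hcr hu hv hvc huv => by
      have := (degrees_of_exchange hTG hT (by omega) hc hmin hcr hu hv hvc huv).1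
      omega
  have hall : ∀ v, v ≠ c → T.Adj c v := fun v hv => by
    by_contra hcv
    have hsub : T.neighborSet c ⊆ ((Finset.univ.erase c).erase v : Finset V) := fun x hx => by
      have hxc : x ≠ c := SimpleGraph.Adj.ne' hx
      have hxv : x ≠ v := by
        rintro rfl
        exact hcv hx
      simp [hxc, hxv]
    have := Set.ncard_le_ncard hsub
    rw [Set.ncard_coe_finset, Finset.card_erase_of_mem (by simp [hv]),
      Finset.card_erase_of_mem (Finset.mem_univ _), Finset.card_univ, hcard] at this
    omega
  refine ⟨c, fun u v => ⟨fun huv => ⟨huv.ne, ?_⟩, ?_⟩⟩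
  · by_contra! h
    exact (neighbors_separated_of_no_exchange hT hex (hall u h.1) (hall v h.2) huv.ne).1 huv
  · rintro ⟨hne, rfl | rfl⟩
    · exact hTG (hall v hne.symm)
    · exact (hTG (hall u hne)).symm

end SpanningTrees

/-- **Theorem (Statement 2).** Let `G` be a connected graph of order `n` with
`6 ≤ n ≤ 11` and `3 ∣ n`. If `λ₁(D(G)) ≤ λ₁(D(G♯))` where
`G♯ = K_{(n-3)/3} ∨ ((2n+3)/3)K₁`, then `G` admits a spanning `4`-tree, unless
`G ≅ G♯`. -/
theorem spanning_four_tree_of_distSpecRad_small {V : Type*} [Fintype V] [DecidableEq V]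
    (n : ℕ) (hcard : Fintype.card V = n) (hn6 : 6 ≤ n) (hn11 : n ≤ 11) (h3 : 3 ∣ n)
    (G : SimpleGraph V) (hG : G.Connected)
    (hspec : distSpecRad G ≤ distSpecRad (sharpGraph n)) :
    HasSpanningKTree G 4 ∨ Nonempty (G ≃g sharpGraph n) := by
  by_contra! hcon
  obtain ⟨hno, hiso⟩ := hcon
  obtain rfl | rfl : n = 6 ∨ n = 9 := by omega
  · obtain ⟨c, hc⟩ := star_of_not_hasSpanningKTree_four hG hcard hno
    obtain ⟨e, he⟩ := exists_equiv_fin_sum_fin {c} (Finset.card_singleton c) (b := 5) hcard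
    refine hiso.false ⟨e, fun {u v} => ?_⟩
    refine (graphJoin_top_bot_adj (e u) (e v)).trans ?_
    rw [hc, he, he, Finset.mem_singleton, Finset.mem_singleton, e.injective.ne_iff]
  · rcases structure_of_not_hasSpanningKTree_four hG hcard hno with
      ⟨c, w, hcw, hcover⟩ | ⟨c, R, hR, hc, hindep, hone⟩
    · exact not_isEmpty_iff.mpr
        (iso_sharpGraph_nine_of_distSpecRad_le G hG hcard c w hcw hcover hspec) hiso
    · exact absurd hspec
        (distSpecRad_sharpGraph_nine_lt G hG hcard c R hR hc hindep hone).not_ge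
end
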